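/- arXiv:2402.10126 — 2 statements merged into one kernel-verified Lean document; each statement's English description precedes it below -/
import Mathlib

section
/- Let (X_n)_{n≥1} be an infinite exchangeable sequence of random variables with values in a Polish space X, with probability law P. Then: (i) with P-probability one, the sequence of empirical distributions F̂_n = (1/n)·Σ_{i=1}^n δ_{X_i} converges weakly as n→∞ to a random probability measure F̃; (ii) for every n≥1 and all measurable sets A_1,…,A_n, P(X_1∈A_1,…,X_n∈A_n) = ∫ Π_{i=1}^n F(A_i) dπ(F), where π is the probability law of F̃ on the space of probability measures on X. -/
open MeasureTheory ProbabilityTheory Filter Topology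
open scoped ENNReal NNReal

/-- A sequence of random variables is exchangeable if its joint law (as a random element of the
path space) is invariant under every finite permutation of the indices. -/
def Exchangeable {Ω 𝕏 : Type*} [MeasurableSpace Ω] [MeasurableSpace 𝕏]
    (μ : Measure Ω) (X : ℕ → Ω → 𝕏) : Prop :=
  ∀ σ : Equiv.Perm ℕ, {n | σ n ≠ n}.Finite →
    Measure.map (fun ω => fun n => X (σ n) ω) μ = Measure.map (fun ω => fun n => X n ω) μ

/-- The empirical distribution `F̂_n = (1/n) ∑_{i=1}^n δ_{X_i}`. -/
noncomputable def empMeas {Ω 𝕏 : Type*} [MeasurableSpace Ω] [MeasurableSpace 𝕏]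
    (X : ℕ → Ω → 𝕏) (n : ℕ) (ω : Ω) : Measure 𝕏 :=
  (n : ℝ≥0∞)⁻¹ • ∑ i ∈ Finset.range n, Measure.dirac (X i ω)

/-- Weak convergence of a sequence of measures, phrased via integrals of bounded continuous
functions. -/
def TendstoWeakly {𝕏 : Type*} [MeasurableSpace 𝕏] [TopologicalSpace 𝕏]
    (ν : ℕ → Measure 𝕏) (ρ : Measure 𝕏) : Prop :=
  ∀ f : BoundedContinuousFunction 𝕏 ℝ,
    Tendsto (fun n => ∫ x, f x ∂(ν n)) atTop (𝓝 (∫ x, f x ∂ρ))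

section PathSpace

variable {𝕏 : Type*}

/-- The transposition of the `i`-th and `j`-th coordinates on the path space. -/
def swapCoord (i j : ℕ) (x : ℕ → 𝕏) : ℕ → 𝕏 := fun n => x (Equiv.swap i j n)

/-- The average of `f` over the first `n` coordinates. -/
noncomputable def coordAverage (f : 𝕏 → ℝ) (n : ℕ) (x : ℕ → 𝕏) : ℝ :=
  (∑ i ∈ Finset.range n, f (x i)) / n

lemma coordAverage_mem_Icc {f : 𝕏 → ℝ} (h01 : ∀ y, f y ∈ Set.Icc (0 : ℝ) 1) (n : ℕ)
    (x : ℕ → 𝕏) : coordAverage f n x ∈ Set.Icc (0 : ℝ) 1 := by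
  refine ⟨div_nonneg (Finset.sum_nonneg fun i _ => (h01 _).1) n.cast_nonneg, ?_⟩
  refine div_le_one_of_le₀ ?_ n.cast_nonneg
  simpa using Finset.sum_le_card_nsmul (Finset.range n) (fun i => f (x i)) 1 fun i _ => (h01 _).2

lemma coordAverage_swapCoord (f : 𝕏 → ℝ) {i j n : ℕ} (hi : i < n) (hj : j < n) (x : ℕ → 𝕏) :
    coordAverage f n (swapCoord i j x) = coordAverage f n x := by
  unfold coordAverage swapCoord
  congr 1
  refine Equiv.Perm.sum_comp (Equiv.swap i j) (Finset.range n) (fun k => f (x k)) fun k hk => ?_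
  simp only [Finset.coe_range, Set.mem_Iio]
  by_contra hkn
  exact hk (Equiv.swap_apply_of_ne_of_ne (by lia) (by lia))

lemma tendsto_coordAverage_of_pow_four {f : 𝕏 → ℝ} (h0 : ∀ y, 0 ≤ f y) {x : ℕ → 𝕏} {l : ℝ}
    (h : Tendsto (fun N : ℕ => coordAverage f ((N + 1) ^ 4) x) atTop (𝓝 l)) :
    Tendsto (fun n => coordAverage f n x) atTop (𝓝 l) := by
  refine tendsto_div_of_monotone_of_exists_subseq_tendsto_div
    (fun n => ∑ i ∈ Finset.range n, f (x i)) l ?_ fun a ha => ⟨fun N => (N + 1) ^ 4, ?_, ?_, h⟩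
  · exact fun n m hnm => Finset.sum_le_sum_of_subset_of_nonneg (by simpa using hnm)
      fun i _ _ => h0 _
  · have hlim : Tendsto (fun N : ℕ => (1 + 1 / ((N : ℝ) + 1)) ^ 4) atTop (𝓝 1) := by
      simpa using ((tendsto_one_div_add_atTop_nhds_zero_nat (𝕜 := ℝ)).const_add 1).pow 4
    filter_upwards [hlim.eventually_le_const ha] with N hN
    have hN0 : (0 : ℝ) < (N : ℝ) + 1 := by positivity
    have : (((N + 1 + 1) ^ 4 : ℕ) : ℝ)
        = (1 + 1 / ((N : ℝ) + 1)) ^ 4 * (((N + 1) ^ 4 : ℕ) : ℝ) := by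
      push_cast
      rw [← mul_pow]
      congr 1
      field_simp
    rw [this]
    gcongr
  · exact tendsto_atTop_mono (fun N => (Nat.le_succ N).trans (Nat.le_self_pow (by simp) _))
      tendsto_id

variable [MeasurableSpace 𝕏]

@[fun_prop]
lemma measurable_swapCoord (i j : ℕ) : Measurable (swapCoord i j : (ℕ → 𝕏) → ℕ → 𝕏) :=
  measurable_pi_lambda _ fun _ => measurable_pi_apply _

/-- The law of a sequence is invariant under every transposition of two coordinates. -/
def SwapInvariant (P : Measure (ℕ → 𝕏)) : Prop := ∀ i j, P.map (swapCoord i j) = P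

/-- The σ-algebra of events that are invariant under every transposition of two coordinates. -/
abbrev swapSigma (𝕏 : Type*) [MeasurableSpace 𝕏] : MeasurableSpace (ℕ → 𝕏) :=
  ⨅ i, ⨅ j, MeasurableSpace.invariants (swapCoord i j)

lemma swapSigma_le : swapSigma 𝕏 ≤ (inferInstance : MeasurableSpace (ℕ → 𝕏)) :=
  (iInf_le _ 0).trans ((iInf_le _ 0).trans (MeasurableSpace.invariants_le _))

lemma measurable_swapSigma {β : Type*} [MeasurableSpace β] {g : (ℕ → 𝕏) → β} (hg : Measurable g)
    (h : ∀ i j x, g (swapCoord i j x) = g x) : Measurable[swapSigma 𝕏] g := by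
  intro s hs
  rw [swapSigma, MeasurableSpace.measurableSet_iInf]
  simp only [MeasurableSpace.measurableSet_iInf]
  intro i j
  refine ⟨hg hs, ?_⟩
  ext x
  simp [h]

lemma apply_swapCoord_of_measurable {β : Type*} [MeasurableSpace β] [MeasurableSingletonClass β]
    {g : (ℕ → 𝕏) → β} (hg : Measurable[swapSigma 𝕏] g) (i j : ℕ) (x : ℕ → 𝕏) :
    g (swapCoord i j x) = g x := by
  have hg' : Measurable[MeasurableSpace.invariants (swapCoord i j)] g :=
    hg.mono ((iInf_le _ i).trans (iInf_le _ j)) le_rfl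
  exact congrFun (MeasurableSpace.comp_eq_of_measurable_invariants hg') x

lemma SwapInvariant.integral_comp {P : Measure (ℕ → 𝕏)} (hP : SwapInvariant P) (i j : ℕ)
    {h : (ℕ → 𝕏) → ℝ} (hh : Measurable h) :
    ∫ x, h (swapCoord i j x) ∂P = ∫ x, h x ∂P := by
  conv_rhs => rw [← hP i j]
  exact (integral_map (by fun_prop) hh.aestronglyMeasurable).symm

@[fun_prop]
lemma measurable_coordAverage {f : 𝕏 → ℝ} (hf : Measurable f) (n : ℕ) :
    Measurable (coordAverage f n) := by
  unfold coordAverage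
  fun_prop

lemma integrable_of_mem_Icc {α : Type*} [MeasurableSpace α] {P : Measure α} [IsFiniteMeasure P]
    {g : α → ℝ} (hg : Measurable g) (h01 : ∀ y, g y ∈ Set.Icc (0 : ℝ) 1) : Integrable g P :=
  Integrable.of_bound hg.aestronglyMeasurable 1
    (ae_of_all _ fun y => abs_le.2 ⟨by linarith [(h01 y).1], (h01 y).2⟩)

section Averages

variable {P : Measure (ℕ → 𝕏)} {f : 𝕏 → ℝ}

lemma SwapInvariant.integral_mul_of_ne (hP : SwapInvariant P) (hf : Measurable f) {i j : ℕ}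
    (hij : i ≠ j) : ∫ x, f (x i) * f (x j) ∂P = ∫ x, f (x 0) * f (x 1) ∂P := by
  have hj : Equiv.swap 0 i j ≠ 0 := fun h => hij (by
    have := congrArg (Equiv.swap 0 i) h
    simpa using this.symm)
  rw [← hP.integral_comp 0 i (h := fun x => f (x i) * f (x j)) (by fun_prop),
    ← hP.integral_comp 1 (Equiv.swap 0 i j) (by unfold swapCoord; fun_prop)]
  refine integral_congr_ae (ae_of_all _ fun x => ?_)
  simp [swapCoord, Equiv.swap_apply_of_ne_of_ne (zero_ne_one' ℕ) hj.symm]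

lemma SwapInvariant.integral_mul_self (hP : SwapInvariant P) (hf : Measurable f) (i : ℕ) :
    ∫ x, f (x i) * f (x i) ∂P = ∫ x, f (x 0) * f (x 0) ∂P := by
  rw [← hP.integral_comp 0 i (h := fun x => f (x i) * f (x i)) (by fun_prop)]
  simp [swapCoord]

variable [IsProbabilityMeasure P]

lemma SwapInvariant.integral_sum_sq_le (hP : SwapInvariant P) (hf : Measurable f)
    (h01 : ∀ y, f y ∈ Set.Icc (0 : ℝ) 1) (s : Finset ℕ) (a : ℕ → ℝ) (ha : ∑ i ∈ s, a i = 0) :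
    ∫ x, (∑ i ∈ s, a i * f (x i)) ^ 2 ∂P ≤ ∑ i ∈ s, a i ^ 2 := by
  set c := ∫ x, f (x 0) * f (x 1) ∂P
  set d := ∫ x, f (x 0) * f (x 0) ∂P
  have h01' : ∀ i j : ℕ, ∀ x : ℕ → 𝕏, f (x i) * f (x j) ∈ Set.Icc (0 : ℝ) 1 := fun i j x =>
    ⟨mul_nonneg (h01 _).1 (h01 _).1, mul_le_one₀ (h01 _).2 (h01 _).1 (h01 _).2⟩
  have hff : ∀ i j : ℕ, Integrable (fun x : ℕ → 𝕏 => f (x i) * f (x j)) P := fun i j =>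
    integrable_of_mem_Icc (by fun_prop) (h01' i j)
  have hc : 0 ≤ c := integral_nonneg fun x => (h01' 0 1 x).1
  have hd : d ≤ 1 := by
    simpa using integral_mono (hff 0 0) (integrable_const (1 : ℝ)) fun x => (h01' 0 0 x).2
  have hcd : ∀ i j, ∫ x, f (x i) * f (x j) ∂P = c + if i = j then d - c else 0 := by
    intro i j
    split_ifs with h
    · subst h
      rw [hP.integral_mul_self hf]
      ring
    · rw [hP.integral_mul_of_ne hf h, add_zero]
  calc ∫ x, (∑ i ∈ s, a i * f (x i)) ^ 2 ∂P
      = ∫ x, ∑ i ∈ s, ∑ j ∈ s, (a i * a j) * (f (x i) * f (x j)) ∂P := by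
        refine integral_congr_ae (ae_of_all _ fun x => ?_)
        simp only [sq, Finset.sum_mul_sum]
        exact Finset.sum_congr rfl fun i _ => Finset.sum_congr rfl fun j _ => by ring
    _ = ∑ i ∈ s, ∑ j ∈ s, (a i * a j) * (c + if i = j then d - c else 0) := by
        rw [integral_finsetSum _ fun i _ => integrable_finsetSum _ fun j _ =>
          (hff i j).const_mul _]
        refine Finset.sum_congr rfl fun i _ => ?_
        rw [integral_finsetSum _ fun j _ => (hff i j).const_mul _]
        refine Finset.sum_congr rfl fun j _ => ?_
        rw [integral_const_mul, hcd]
    _ = (∑ i ∈ s, a i) * (∑ j ∈ s, a j) * c + (d - c) * ∑ i ∈ s, a i ^ 2 := by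
        rw [Finset.sum_mul_sum]
        simp only [mul_add, Finset.sum_add_distrib, mul_ite, mul_zero, Finset.sum_ite_eq,
          Finset.sum_mul, Finset.mul_sum]
        congr 1
        refine Finset.sum_congr rfl fun i hi => ?_
        rw [if_pos hi]
        ring
    _ ≤ ∑ i ∈ s, a i ^ 2 := by
        rw [ha, zero_mul, zero_mul, zero_add]
        exact mul_le_of_le_one_left (Finset.sum_nonneg fun i _ => sq_nonneg _) (by linarith)

lemma sum_range_max_ite {n m : ℕ} (g : ℕ → ℝ) :
    ∑ i ∈ Finset.range (max n m), (if i < n then g i else 0) = ∑ i ∈ Finset.range n, g i := by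
  rw [← Finset.sum_filter]
  refine Finset.sum_congr ?_ fun _ _ => rfl
  ext i
  simp only [Finset.mem_filter, Finset.mem_range]
  lia

lemma SwapInvariant.integral_coordAverage_sub_sq_le (hP : SwapInvariant P) (hf : Measurable f)
    (h01 : ∀ y, f y ∈ Set.Icc (0 : ℝ) 1) {n m : ℕ} (hn : 0 < n) (hm : 0 < m) :
    ∫ x, (coordAverage f n x - coordAverage f m x) ^ 2 ∂P ≤ 2 / n + 2 / m := by
  have hn' : (n : ℝ) ≠ 0 := by positivity
  have hm' : (m : ℝ) ≠ 0 := by positivity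
  have hsn : ∀ g : ℕ → ℝ, ∑ i ∈ Finset.range (max n m), (if i < n then g i else 0)
      = ∑ i ∈ Finset.range n, g i := sum_range_max_ite
  have hsm : ∀ g : ℕ → ℝ, ∑ i ∈ Finset.range (max n m), (if i < m then g i else 0)
      = ∑ i ∈ Finset.range m, g i := by
    rw [max_comm]
    exact sum_range_max_ite
  set a : ℕ → ℝ := fun i => (if i < n then (n : ℝ)⁻¹ else 0) - if i < m then (m : ℝ)⁻¹ else 0
    with ha
  have hsum : ∑ i ∈ Finset.range (max n m), a i = 0 := by
    simp only [ha, Finset.sum_sub_distrib, hsn, hsm]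
    simp [hn', hm']
  have hrep : ∀ x : ℕ → 𝕏, coordAverage f n x - coordAverage f m x
      = ∑ i ∈ Finset.range (max n m), a i * f (x i) := by
    intro x
    simp only [ha, sub_mul, ite_mul, zero_mul, Finset.sum_sub_distrib, hsn, hsm, coordAverage,
      ← Finset.mul_sum]
    ring
  simp only [hrep]
  refine (hP.integral_sum_sq_le hf h01 _ a hsum).trans ?_
  calc ∑ i ∈ Finset.range (max n m), a i ^ 2
      ≤ ∑ i ∈ Finset.range (max n m), ((if i < n then 2 * (n : ℝ)⁻¹ ^ 2 else 0)
          + if i < m then 2 * (m : ℝ)⁻¹ ^ 2 else 0) := by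
        refine Finset.sum_le_sum fun i _ => ?_
        simp only [ha]
        split_ifs <;> nlinarith [sq_nonneg ((n : ℝ)⁻¹ + (m : ℝ)⁻¹), sq_nonneg (n : ℝ)⁻¹,
          sq_nonneg (m : ℝ)⁻¹]
    _ = 2 / n + 2 / m := by
        rw [Finset.sum_add_distrib, hsn, hsm]
        simp
        field_simp

lemma SwapInvariant.ae_exists_tendsto_coordAverage (hP : SwapInvariant P) (hf : Measurable f)
    (h01 : ∀ y, f y ∈ Set.Icc (0 : ℝ) 1) :
    ∀ᵐ x ∂P, ∃ l, Tendsto (fun n => coordAverage f n x) atTop (𝓝 l) := by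
  have hmain : ∀ᵐ x ∂P, ∃ l,
      Tendsto (fun N : ℕ => coordAverage f ((N + 1) ^ 4) x) atTop (𝓝 l) := by
    refine Lp.ae_tendsto_of_cauchy_eLpNorm (p := 2)
      (B := fun N : ℕ => ENNReal.ofReal (3 * (1 / ((N + 1 : ℕ) : ℝ) ^ 2)))
      (fun N => (measurable_coordAverage hf _).aestronglyMeasurable) (by norm_num) ?_ ?_
    · rw [← ENNReal.ofReal_tsum_of_nonneg (fun N => by positivity)]
      · exact ENNReal.ofReal_ne_top
      · exact (((summable_nat_add_iff 1).2
          (Real.summable_one_div_nat_pow.2 one_lt_two)).mul_left 3)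
    · intro N n m hn hm
      have hmem : MemLp (coordAverage f ((n + 1) ^ 4) - coordAverage f ((m + 1) ^ 4)) 2 P := by
        refine MemLp.of_bound (by fun_prop) 1 (ae_of_all _ fun x => abs_le.2 ?_)
        have h1 := coordAverage_mem_Icc h01 ((n + 1) ^ 4) x
        have h2 := coordAverage_mem_Icc h01 ((m + 1) ^ 4) x
        simp only [Pi.sub_apply]
        constructor <;> linarith [h1.1, h1.2, h2.1, h2.2]
      rw [hmem.eLpNorm_eq_integral_rpow_norm two_ne_zero ENNReal.ofNat_ne_top]
      refine (ENNReal.ofReal_lt_ofReal_iff (by positivity)).2 ?_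
      have hle := hP.integral_coordAverage_sub_sq_le hf h01 (n := (n + 1) ^ 4)
        (m := (m + 1) ^ 4) (by positivity) (by positivity)
      have hb : ∀ k : ℕ, N ≤ k → 2 / (((k + 1) ^ 4 : ℕ) : ℝ) ≤ 2 / ((N + 1 : ℕ) : ℝ) ^ 4 := by
        intro k hk
        push_cast
        gcongr
      have hle' : ∫ x, (coordAverage f ((n + 1) ^ 4) x - coordAverage f ((m + 1) ^ 4) x) ^ 2 ∂P
          ≤ (2 * (1 / ((N + 1 : ℕ) : ℝ) ^ 2)) ^ 2 := by
        refine hle.trans ((add_le_add (hb n hn) (hb m hm)).trans (le_of_eq ?_))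
        field_simp
        norm_num
      simp only [ENNReal.toReal_ofNat, Real.norm_eq_abs, Pi.sub_apply, Real.rpow_two, sq_abs]
      rw [← one_div, ← Real.sqrt_eq_rpow]
      refine ((Real.sqrt_le_sqrt hle').trans_eq (Real.sqrt_sq (by positivity))).trans_lt ?_
      have : (0 : ℝ) < 1 / ((N + 1 : ℕ) : ℝ) ^ 2 := by positivity
      linarith
  filter_upwards [hmain] with x ⟨l, hl⟩
  exact ⟨l, tendsto_coordAverage_of_pow_four (fun y => (h01 y).1) hl⟩

lemma integral_limit_mul_eq (hf : Measurable f) (h01 : ∀ y, f y ∈ Set.Icc (0 : ℝ) 1)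
    {Y W : (ℕ → 𝕏) → ℝ} (hY : ∀ᵐ x ∂P, Tendsto (fun n => coordAverage f n x) atTop (𝓝 (Y x)))
    (hW : Measurable W) (hW01 : ∀ x, W x ∈ Set.Icc (0 : ℝ) 1) {c : ℝ} {K : ℕ}
    (hc : ∀ j, K ≤ j → ∫ x, f (x j) * W x ∂P = c) :
    ∫ x, Y x * W x ∂P = c := by
  have hprod : ∀ {u v : ℝ}, u ∈ Set.Icc (0 : ℝ) 1 → v ∈ Set.Icc (0 : ℝ) 1 →
      u * v ∈ Set.Icc (0 : ℝ) 1 := fun hu hv =>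
    ⟨mul_nonneg hu.1 hv.1, mul_le_one₀ hu.2 hv.1 hv.2⟩
  have h1 : Tendsto (fun n => ∫ x, coordAverage f n x * W x ∂P) atTop
      (𝓝 (∫ x, Y x * W x ∂P)) := by
    refine tendsto_integral_of_dominated_convergence (fun _ => 1)
      (fun n => by fun_prop) (integrable_const _) (fun n => ae_of_all _ fun x => ?_) ?_
    · have := hprod (coordAverage_mem_Icc h01 n x) (hW01 x)
      exact abs_le.2 ⟨by linarith [this.1], this.2⟩
    · filter_upwards [hY] with x hx using hx.mul_const _
  have h2 : Tendsto (fun j => ∫ x, f (x j) * W x ∂P) atTop (𝓝 c) :=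
    tendsto_const_nhds.congr' (eventually_atTop.2 ⟨K, fun j hj => (hc j hj).symm⟩)
  refine tendsto_nhds_unique h1 (h2.cesaro.congr fun n => ?_)
  rw [← integral_finsetSum _ fun i _ =>
    integrable_of_mem_Icc (by fun_prop) fun x => hprod (h01 _) (hW01 x), ← integral_const_mul]
  refine integral_congr_ae (ae_of_all _ fun x => ?_)
  simp only [coordAverage, ← Finset.sum_mul]
  ring

end Averages

section Directing

variable [StandardBorelSpace 𝕏] {P : Measure (ℕ → 𝕏)} [IsProbabilityMeasure P]

/-- The conditional law of the first coordinate given the swap-invariant events. -/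
noncomputable def directingMeasure (P : Measure (ℕ → 𝕏)) [IsProbabilityMeasure P] (x : ℕ → 𝕏) :
    Measure 𝕏 :=
  (condExpKernel P (swapSigma 𝕏) x).map (fun y => y 0)

instance isProbabilityMeasure_directingMeasure (x : ℕ → 𝕏) :
    IsProbabilityMeasure (directingMeasure P x) :=
  Measure.isProbabilityMeasure_map (measurable_pi_apply 0).aemeasurable

lemma measurable_swapSigma_directingMeasure : Measurable[swapSigma 𝕏] (directingMeasure P) :=
  (Measure.measurable_map _ (measurable_pi_apply 0)).comp
    (condExpKernel P (swapSigma 𝕏)).measurable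

lemma measurable_swapSigma_directingMeasure_real {A : Set 𝕏} (hA : MeasurableSet A) :
    Measurable[swapSigma 𝕏] fun x => (directingMeasure P x).real A :=
  ((Measure.measurable_coe hA).comp measurable_swapSigma_directingMeasure).ennreal_toReal

lemma indicator_one_mem_Icc {α : Type*} (A : Set α) (y : α) :
    A.indicator (fun _ => (1 : ℝ)) y ∈ Set.Icc (0 : ℝ) 1 := by
  by_cases hy : y ∈ A <;> simp [hy]

lemma SwapInvariant.ae_tendsto_coordAverage_indicator (hP : SwapInvariant P) {A : Set 𝕏}
    (hA : MeasurableSet A) :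
    ∀ᵐ x ∂P, Tendsto (fun n => coordAverage (A.indicator fun _ => 1) n x) atTop
      (𝓝 ((directingMeasure P x).real A)) := by
  set f : 𝕏 → ℝ := A.indicator fun _ => 1
  have hf : Measurable f := measurable_const.indicator hA
  have h01 : ∀ y, f y ∈ Set.Icc (0 : ℝ) 1 := indicator_one_mem_Icc A
  set Y : (ℕ → 𝕏) → ℝ := fun x => limsup (fun n => coordAverage f n x) atTop
  have hY : ∀ᵐ x ∂P, Tendsto (fun n => coordAverage f n x) atTop (𝓝 (Y x)) := by
    filter_upwards [hP.ae_exists_tendsto_coordAverage hf h01] with x ⟨l, hl⟩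
    simpa only [Y, hl.limsup_eq] using hl
  have hYm : Measurable Y := Measurable.limsup fun n => measurable_coordAverage hf n
  have hYT : Measurable[swapSigma 𝕏] Y := by
    refine measurable_swapSigma hYm fun i j x => limsup_congr ?_
    filter_upwards [eventually_gt_atTop i, eventually_gt_atTop j] with n hi hj
    exact coordAverage_swapCoord f hi hj x
  have hYint : Integrable Y P := by
    refine Integrable.of_bound hYm.aestronglyMeasurable 1 ?_
    filter_upwards [hY] with x hx
    have := isClosed_Icc.mem_of_tendsto hx
      (Eventually.of_forall fun n => coordAverage_mem_Icc h01 n x)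
    exact abs_le.2 ⟨by linarith [this.1], this.2⟩
  have hA0 : MeasurableSet ((fun y : ℕ → 𝕏 => y 0) ⁻¹' A) := measurable_pi_apply 0 hA
  have hcond : Y =ᵐ[P] P⟦(fun y : ℕ → 𝕏 => y 0) ⁻¹' A | swapSigma 𝕏⟧ := by
    refine ae_eq_condExp_of_forall_setIntegral_eq swapSigma_le
      ((integrable_const 1).indicator hA0) (fun s _ _ => hYint.integrableOn) (fun s hs _ => ?_)
      hYT.aestronglyMeasurable
    have hs' : MeasurableSet s := swapSigma_le s hs
    have hW : Measurable[swapSigma 𝕏] (s.indicator fun _ => (1 : ℝ)) :=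
      Measurable.indicator (@measurable_const _ _ _ (swapSigma 𝕏) _) hs
    have hmul : ∀ g : (ℕ → 𝕏) → ℝ,
        ∫ x in s, g x ∂P = ∫ x, g x * s.indicator (fun _ => (1 : ℝ)) x ∂P := by
      intro g
      rw [← integral_indicator hs']
      refine integral_congr_ae (ae_of_all _ fun x => ?_)
      by_cases hx : x ∈ s <;> simp [hx]
    rw [hmul, hmul]
    refine integral_limit_mul_eq hf h01 hY (hW.mono swapSigma_le le_rfl)
      (indicator_one_mem_Icc s) (K := 0) fun j _ => ?_
    rw [← hP.integral_comp 0 j (h := fun x => ((fun y : ℕ → 𝕏 => y 0) ⁻¹' A).indicator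
        (fun _ => (1 : ℝ)) x * s.indicator (fun _ => (1 : ℝ)) x)
      ((measurable_const.indicator hA0).mul (hW.mono swapSigma_le le_rfl))]
    refine integral_congr_ae (ae_of_all _ fun x => ?_)
    simp only [apply_swapCoord_of_measurable hW]
    change f (x j) * _ = f (swapCoord 0 j x 0) * _
    simp [swapCoord]
  filter_upwards [hY, hcond, condExpKernel_ae_eq_condExp swapSigma_le hA0] with x h1 h2 h3
  rw [directingMeasure, map_measureReal_apply (measurable_pi_apply 0) hA, h3, ← h2]
  exact h1

lemma prod_mem_Icc {ι : Type*} (s : Finset ι) {g : ι → ℝ} (h : ∀ i, g i ∈ Set.Icc (0 : ℝ) 1) :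
    ∏ i ∈ s, g i ∈ Set.Icc (0 : ℝ) 1 :=
  ⟨Finset.prod_nonneg fun i _ => (h i).1, Finset.prod_le_one (fun i _ => (h i).1) fun i _ => (h i).2⟩

lemma measureReal_mem_Icc {α : Type*} [MeasurableSpace α] (ν : Measure α) [IsProbabilityMeasure ν]
    (A : Set α) : ν.real A ∈ Set.Icc (0 : ℝ) 1 :=
  ⟨measureReal_nonneg, measureReal_le_one⟩

lemma SwapInvariant.integral_prod_indicator_mul (hP : SwapInvariant P) {A : ℕ → Set 𝕏}
    (hA : ∀ i, MeasurableSet (A i)) (s : Finset ℕ) {W : (ℕ → 𝕏) → ℝ}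
    (hW : Measurable[swapSigma 𝕏] W) (hW01 : ∀ x, W x ∈ Set.Icc (0 : ℝ) 1) :
    ∫ x, (∏ i ∈ s, (A i).indicator (fun _ => (1 : ℝ)) (x i)) * W x ∂P
      = ∫ x, (∏ i ∈ s, (directingMeasure P x).real (A i)) * W x ∂P := by
  have hmul : ∀ {u v : ℝ}, u ∈ Set.Icc (0 : ℝ) 1 → v ∈ Set.Icc (0 : ℝ) 1 →
      u * v ∈ Set.Icc (0 : ℝ) 1 := fun hu hv =>
    ⟨mul_nonneg hu.1 hv.1, mul_le_one₀ hu.2 hv.1 hv.2⟩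
  have hind : ∀ i, Measurable ((A i).indicator (fun _ => (1 : ℝ))) := fun i =>
    measurable_const.indicator (hA i)
  induction s using Finset.induction_on generalizing W with
  | empty => simp
  | insert a s ha ih =>
    have hWm : Measurable W := hW.mono swapSigma_le le_rfl
    set V : (ℕ → 𝕏) → ℝ := fun x => (∏ i ∈ s, (A i).indicator (fun _ => (1 : ℝ)) (x i)) * W x
    have hV : Measurable V := by fun_prop
    have hV01 : ∀ x, V x ∈ Set.Icc (0 : ℝ) 1 := fun x =>
      hmul (prod_mem_Icc s fun i => indicator_one_mem_Icc _ _) (hW01 x)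
    have key : ∫ x, (directingMeasure P x).real (A a) * V x ∂P
        = ∫ x, (A a).indicator (fun _ => (1 : ℝ)) (x a) * V x ∂P := by
      refine integral_limit_mul_eq (hind a) (indicator_one_mem_Icc _)
        (hP.ae_tendsto_coordAverage_indicator (hA a)) hV hV01 (K := s.sup id + 1) fun j hj => ?_
      rw [← hP.integral_comp a j (by fun_prop)]
      refine integral_congr_ae (ae_of_all _ fun x => ?_)
      have hprod : ∏ i ∈ s, (A i).indicator (fun _ => (1 : ℝ)) (swapCoord a j x i)
          = ∏ i ∈ s, (A i).indicator (fun _ => (1 : ℝ)) (x i) := by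
        refine Finset.prod_congr rfl fun i hi => ?_
        have hij : i ≤ s.sup id := Finset.le_sup (f := id) hi
        have hia : i ≠ a := by
          rintro rfl
          exact ha hi
        rw [swapCoord, Equiv.swap_apply_of_ne_of_ne hia (by lia)]
      simp only [V, hprod, apply_swapCoord_of_measurable hW]
      simp [swapCoord]
    have ihW := ih (W := fun x => (directingMeasure P x).real (A a) * W x)
      ((measurable_swapSigma_directingMeasure_real (hA a)).mul hW)
      (fun x => hmul (measureReal_mem_Icc _ _) (hW01 x))
    simp only [Finset.prod_insert ha, mul_assoc]
    refine key.symm.trans (Eq.trans ?_ (ihW.trans ?_)) <;>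
    · refine integral_congr_ae (ae_of_all _ fun x => ?_)
      simp only [V]
      ring

lemma SwapInvariant.measure_forall_mem (hP : SwapInvariant P) {A : ℕ → Set 𝕏}
    (hA : ∀ i, MeasurableSet (A i)) (s : Finset ℕ) :
    P {x | ∀ i ∈ s, x i ∈ A i} = ∫⁻ x, ∏ i ∈ s, directingMeasure P x (A i) ∂P := by
  have hset : MeasurableSet {x : ℕ → 𝕏 | ∀ i ∈ s, x i ∈ A i} := by
    have : {x : ℕ → 𝕏 | ∀ i ∈ s, x i ∈ A i} = ⋂ i ∈ s, (fun x => x i) ⁻¹' A i := by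
      ext x
      simp
    rw [this]
    exact s.measurableSet_biInter fun i _ => measurable_pi_apply i (hA i)
  have hreal : ∀ i, Measurable fun x => (directingMeasure P x).real (A i) := fun i =>
    (measurable_swapSigma_directingMeasure_real (hA i)).mono swapSigma_le le_rfl
  have h := hP.integral_prod_indicator_mul hA s (W := fun _ => 1)
    (@measurable_const _ _ _ (swapSigma 𝕏) _) (fun _ => by simp)
  simp only [mul_one] at h
  have hl : ∀ x : ℕ → 𝕏, ∏ i ∈ s, (A i).indicator (fun _ => (1 : ℝ)) (x i)
      = {x : ℕ → 𝕏 | ∀ i ∈ s, x i ∈ A i}.indicator 1 x := by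
    intro x
    classical
    simp only [Set.indicator_apply, Finset.prod_ite_zero, Finset.prod_const_one,
      Set.mem_ofPred_eq, Pi.one_apply]
  simp only [hl, integral_indicator_one hset] at h
  rw [← ofReal_measureReal, h, ofReal_integral_eq_lintegral_ofReal
    (integrable_of_mem_Icc (by fun_prop) fun x => prod_mem_Icc s fun i => measureReal_mem_Icc _ _)
    (ae_of_all _ fun x => (prod_mem_Icc s fun i => measureReal_mem_Icc _ _).1)]
  refine lintegral_congr fun x => ?_
  rw [ENNReal.ofReal_prod_of_nonneg fun i _ => measureReal_nonneg]
  simp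

end Directing

end PathSpace

section Empirical

variable {Ω 𝕏 : Type*} [MeasurableSpace Ω] [MeasurableSpace 𝕏]

lemma Exchangeable.swapInvariant {μ : Measure Ω} {X : ℕ → Ω → 𝕏} (hX : ∀ n, Measurable (X n))
    (h : Exchangeable μ X) : SwapInvariant (μ.map fun ω n => X n ω) := by
  intro i j
  rw [Measure.map_map (measurable_swapCoord i j) (measurable_pi_lambda _ hX)]
  refine h (Equiv.swap i j) ((Set.toFinite {i, j}).subset fun n hn => ?_)
  by_contra hne
  simp only [Set.mem_insert_iff, Set.mem_singleton_iff, not_or] at hne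
  exact hn (Equiv.swap_apply_of_ne_of_ne hne.1 hne.2)

lemma isProbabilityMeasure_empMeas (X : ℕ → Ω → 𝕏) {n : ℕ} (hn : n ≠ 0) (ω : Ω) :
    IsProbabilityMeasure (empMeas X n ω) := by
  refine ⟨?_⟩
  simp [empMeas, ENNReal.inv_mul_cancel, hn]

lemma empMeas_real_apply (X : ℕ → Ω → 𝕏) (n : ℕ) (ω : Ω) {A : Set 𝕏} (hA : MeasurableSet A) :
    (empMeas X n ω).real A = coordAverage (A.indicator fun _ => 1) n fun k => X k ω := by
  have hdirac : ∀ i, (Measure.dirac (X i ω) A).toReal = A.indicator (fun _ => (1 : ℝ)) (X i ω) := by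
    intro i
    by_cases h : X i ω ∈ A <;> simp [Measure.dirac_apply' _ hA, h]
  simp only [empMeas, measureReal_def, Measure.smul_apply, Measure.finsetSum_apply, smul_eq_mul,
    ENNReal.toReal_mul, ENNReal.toReal_inv, ENNReal.toReal_natCast, coordAverage]
  rw [ENNReal.toReal_sum fun i _ => measure_ne_top _ _]
  simp only [hdirac]
  ring

lemma exists_countable_isPiSystem_isOpen (α : Type*) [TopologicalSpace α]
    [SecondCountableTopology α] : ∃ S : Set (Set α), S.Countable ∧ IsPiSystem S ∧
      (∀ s ∈ S, IsOpen s) ∧ ∀ u, IsOpen u → ∀ x ∈ u, ∃ s ∈ S, s ∈ 𝓝 x ∧ s ⊆ u := by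
  have hb := TopologicalSpace.isBasis_countableBasis α
  refine ⟨Set.sInter '' {t | t.Finite ∧ t ⊆ TopologicalSpace.countableBasis α},
    (Set.countable_ofPred_finite_subset (TopologicalSpace.countable_countableBasis α)).image _,
    ?_, ?_, ?_⟩
  · rintro _ ⟨t, ht, rfl⟩ _ ⟨t', ht', rfl⟩ -
    exact ⟨t ∪ t', ⟨ht.1.union ht'.1, Set.union_subset ht.2 ht'.2⟩, Set.sInter_union t t'⟩
  · rintro _ ⟨t, ht, rfl⟩
    exact ht.1.isOpen_sInter fun s hs => hb.isOpen (ht.2 hs)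
  · intro u hu x hx
    obtain ⟨v, hv, hxv, hvu⟩ := hb.exists_subset_of_mem_open hx hu
    exact ⟨v, ⟨{v}, ⟨Set.finite_singleton v, by simpa using hv⟩, Set.sInter_singleton v⟩,
      (hb.isOpen hv).mem_nhds hxv, hvu⟩

lemma tendstoWeakly_empMeas [TopologicalSpace 𝕏] [SecondCountableTopology 𝕏]
    [OpensMeasurableSpace 𝕏] {S : Set (Set 𝕏)} (hS : IsPiSystem S) (hopen : ∀ s ∈ S, IsOpen s)
    (hnhds : ∀ u, IsOpen u → ∀ x ∈ u, ∃ s ∈ S, s ∈ 𝓝 x ∧ s ⊆ u) (X : ℕ → Ω → 𝕏) (ω : Ω)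
    (ρ : Measure 𝕏) [IsProbabilityMeasure ρ]
    (h : ∀ s ∈ S, Tendsto (fun n => (empMeas X n ω).real s) atTop (𝓝 (ρ.real s))) :
    TendstoWeakly (fun n => empMeas X n ω) ρ := by
  let ν : ℕ → ProbabilityMeasure 𝕏 := fun n =>
    ⟨empMeas X (n + 1) ω, isProbabilityMeasure_empMeas X n.succ_ne_zero ω⟩
  let ρ' : ProbabilityMeasure 𝕏 := ⟨ρ, inferInstance⟩
  have hconv : Tendsto ν atTop (𝓝 ρ') := by
    refine hS.tendsto_probabilityMeasure_of_tendsto_of_mem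
      (fun s hs => (hopen s hs).measurableSet) hnhds fun s hs => ?_
    rw [← NNReal.tendsto_coe]
    exact (tendsto_add_atTop_iff_nat 1).2 (h s hs)
  intro f
  exact (tendsto_add_atTop_iff_nat 1).1
    (ProbabilityMeasure.tendsto_iff_forall_integral_tendsto.1 hconv f)

end Empirical

/-- **de Finetti's law of large numbers and representation theorem.**
If `(X_n)` is an infinite exchangeable sequence with values in a Polish space, then with
probability one the empirical distributions converge weakly to a random probability measure `F̃`,
and the law of `(X_1,…,X_n)` is a mixture of i.i.d. laws directed by the law of `F̃`. -/
theorem statement0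
    {Ω 𝕏 : Type*} [MeasurableSpace Ω] [MeasurableSpace 𝕏] [TopologicalSpace 𝕏]
    [PolishSpace 𝕏] [BorelSpace 𝕏]
    (μ : Measure Ω) [IsProbabilityMeasure μ]
    (X : ℕ → Ω → 𝕏) (hX : ∀ n, Measurable (X n))
    (hexch : Exchangeable μ X) :
    ∃ F : Ω → Measure 𝕏,
      Measurable F ∧
      (∀ ω, IsProbabilityMeasure (F ω)) ∧
      (∀ᵐ ω ∂μ, TendstoWeakly (fun n => empMeas X n ω) (F ω)) ∧
      (∀ (n : ℕ) (A : Fin n → Set 𝕏), (∀ i, MeasurableSet (A i)) →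
        μ {ω | ∀ i : Fin n, X i ω ∈ A i} = ∫⁻ ω, ∏ i : Fin n, F ω (A i) ∂μ) := by
  have hpath : Measurable fun ω n => X n ω := measurable_pi_lambda _ hX
  set P : Measure (ℕ → 𝕏) := μ.map fun ω n => X n ω
  have : IsProbabilityMeasure P := Measure.isProbabilityMeasure_map hpath.aemeasurable
  have hP : SwapInvariant P := hexch.swapInvariant hX
  have hF : Measurable (directingMeasure P) :=
    measurable_swapSigma_directingMeasure.mono swapSigma_le le_rfl
  refine ⟨fun ω => directingMeasure P fun n => X n ω, hF.comp hpath, fun ω => inferInstance,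
    ?_, fun n A hA => ?_⟩
  · obtain ⟨S, hSc, hS, hopen, hnhds⟩ := exists_countable_isPiSystem_isOpen 𝕏
    have hconv : ∀ᵐ x ∂P, ∀ s ∈ S, Tendsto (fun n => coordAverage (s.indicator fun _ => 1) n x)
        atTop (𝓝 ((directingMeasure P x).real s)) :=
      (ae_ball_iff hSc).2 fun s hs =>
        hP.ae_tendsto_coordAverage_indicator (hopen s hs).measurableSet
    filter_upwards [ae_of_ae_map hpath.aemeasurable hconv] with ω hω
    refine tendstoWeakly_empMeas hS hopen hnhds X ω _ fun s hs => ?_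
    simpa only [empMeas_real_apply X _ ω (hopen s hs).measurableSet] using hω s hs
  · set B : ℕ → Set 𝕏 := fun i => if h : i < n then A ⟨i, h⟩ else Set.univ with hB_def
    have hBA : ∀ i : Fin n, B i = A i := fun i => by simp [hB_def]
    have hB : ∀ i, MeasurableSet (B i) := fun i => by
      by_cases h : i < n
      · simpa [hB_def, h] using hA ⟨i, h⟩
      · simp [hB_def, h]
    have hset : MeasurableSet {x : ℕ → 𝕏 | ∀ i : Fin n, x i ∈ A i} := by
      rw [Set.ofPred_forall]
      exact MeasurableSet.iInter fun i => measurable_pi_apply (i : ℕ) (hA i)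
    have hsets : {x : ℕ → 𝕏 | ∀ i : Fin n, x i ∈ A i} = {x | ∀ i ∈ Finset.range n, x i ∈ B i} := by
      ext x
      simp only [Set.mem_ofPred_eq, ← hBA, Finset.mem_range]
      exact ⟨fun h i hi => h ⟨i, hi⟩, fun h i => h i i.2⟩
    have hprod : ∀ x, ∏ i ∈ Finset.range n, directingMeasure P x (B i)
        = ∏ i : Fin n, directingMeasure P x (A i) := fun x => by
      simp only [Finset.prod_range, hBA]
    have h := hP.measure_forall_mem hB (Finset.range n)
    simp only [hprod] at h
    rw [← hsets, Measure.map_apply hpath hset, lintegral_map _ hpath] at h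
    · exact h
    · exact Finset.measurable_fun_prod _ fun i _ => (Measure.measurable_coe (hA i)).comp hF
end

section
/- Let X be a finite or countable set with at least two points, and let (X_n)_{n≥0} be a process with values in X, starting at x_0, which is recurrent (the initial state x_0 is visited infinitely many times with probability one). If (X_n)_{n≥0} is Markov exchangeable, then: (i) with probability one, the matrix of normalized transition counts [T̂^{(n)}_{i,j}] converges, in the topology of coordinatewise convergence, to a random stochastic matrix Q̃; (ii) conditionally on Q̃, the process (X_n)_{n≥0} is a Markov chain with transition matrix Q̃. -/
open MeasureTheory ProbabilityTheory Filter Topology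
open scoped ENNReal NNReal

/-- The number of transitions from state `i` to state `j` in the string `(u 0, …, u n)`. -/
noncomputable def transCount {𝕊 : Type*} (n : ℕ) (i j : 𝕊) (u : ℕ → 𝕊) : ℕ :=
  {m | m < n ∧ u m = i ∧ u (m + 1) = j}.ncard

/-- The number of visits to state `i` among `(u 0, …, u (n-1))`, i.e. the row sum
`∑_k T^{(n)}_{i,k}` of the transition counts. -/
noncomputable def visitCount {𝕊 : Type*} (n : ℕ) (i : 𝕊) (u : ℕ → 𝕊) : ℕ :=
  {m | m < n ∧ u m = i}.ncard

/-- A process `(X_n)_{n≥0}` is Markov exchangeable (partially exchangeable in the sense of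
Diaconis and Freedman) if any two strings with the same initial state and the same transition
counts have the same probability. -/
def MarkovExchangeable {Ω 𝕊 : Type*} [MeasurableSpace Ω]
    (μ : Measure Ω) (Z : ℕ → Ω → 𝕊) : Prop :=
  ∀ (n : ℕ) (u v : ℕ → 𝕊), u 0 = v 0 →
    (∀ i j : 𝕊, transCount n i j u = transCount n i j v) →
    μ {ω | ∀ m ≤ n, Z m ω = u m} = μ {ω | ∀ m ≤ n, Z m ω = v m}

namespace MarkovExchangeable

section Path

variable {𝕊 : Type*}

/-- Sums over the transitions of a path. Both transition and visit counts are of this form. -/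
def transSum (f : 𝕊 → 𝕊 → ℕ) (n : ℕ) (p : ℕ → 𝕊) : ℕ :=
  ∑ m ∈ Finset.range n, f (p m) (p (m + 1))

open Classical in
lemma ncard_lt_eq_sum (P : ℕ → Prop) (n : ℕ) :
    {m | m < n ∧ P m}.ncard = ∑ m ∈ Finset.range n, if P m then 1 else 0 := by
  rw [Finset.sum_boole, ← Set.ncard_coe_finset]
  simp

open Classical in
lemma transCount_eq_transSum (n : ℕ) (i j : 𝕊) (p : ℕ → 𝕊) :
    transCount n i j p = transSum (fun x y => if x = i ∧ y = j then 1 else 0) n p := by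
  rw [transCount, ncard_lt_eq_sum, transSum]
  congr! 2

open Classical in
lemma visitCount_eq_transSum (n : ℕ) (i : 𝕊) (p : ℕ → 𝕊) :
    visitCount n i p = transSum (fun x _ => if x = i then 1 else 0) n p :=
  ncard_lt_eq_sum _ n

open Classical in
lemma visitCount_eq_count (n : ℕ) (i : 𝕊) (p : ℕ → 𝕊) :
    visitCount n i p = Nat.count (fun m => p m = i) n := by
  rw [visitCount_eq_transSum, Nat.count_eq_card_filter_range, transSum, Finset.sum_boole]
  simp

open Classical in
lemma visitCount_succ (n : ℕ) (i : 𝕊) (p : ℕ → 𝕊) :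
    visitCount (n + 1) i p = visitCount n i p + if p n = i then 1 else 0 := by
  simp only [visitCount_eq_transSum, transSum, Finset.sum_range_succ]

open Classical in
lemma transCount_succ (n : ℕ) (i j : 𝕊) (p : ℕ → 𝕊) :
    transCount (n + 1) i j p
      = transCount n i j p + if p n = i ∧ p (n + 1) = j then 1 else 0 := by
  simp only [transCount_eq_transSum, transSum, Finset.sum_range_succ]

lemma sum_transCount_le_visitCount (s : Finset 𝕊) (n : ℕ) (i : 𝕊) (p : ℕ → 𝕊) :
    ∑ j ∈ s, transCount n i j p ≤ visitCount n i p := by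
  classical
  simp only [transCount_eq_transSum, visitCount_eq_transSum, transSum]
  rw [Finset.sum_comm]
  refine Finset.sum_le_sum fun m _ => ?_
  by_cases h : p m = i <;> simp [h]
  split_ifs <;> simp

lemma visitCount_mono (i : 𝕊) (p : ℕ → 𝕊) : Monotone fun n => visitCount n i p := by
  classical
  exact monotone_nat_of_le_succ fun n => by rw [visitCount_succ]; exact Nat.le_add_right _ _

lemma transSum_congr {f : 𝕊 → 𝕊 → ℕ} {n : ℕ} {p q : ℕ → 𝕊} (h : ∀ m ≤ n, p m = q m) :
    transSum f n p = transSum f n q :=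
  Finset.sum_congr rfl fun m hm => by
    have := Finset.mem_range.1 hm
    rw [h m (by omega), h (m + 1) (by omega)]

lemma visitCount_congr {i : 𝕊} {n : ℕ} {p q : ℕ → 𝕊} (h : ∀ m ≤ n, p m = q m) :
    visitCount n i p = visitCount n i q := by
  classical
  simpa only [visitCount_eq_transSum] using transSum_congr h

/-- The time of the `k`-th visit to `i` (counting from zero). -/
noncomputable def visitTime (i : 𝕊) (k : ℕ) (p : ℕ → 𝕊) : ℕ :=
  Nat.nth (fun m => p m = i) k

/-- The paths that visit `i` infinitely often. -/
def recurrentSet (i : 𝕊) : Set (ℕ → 𝕊) := {p | {n | p n = i}.Infinite}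

variable {i : 𝕊} {p : ℕ → 𝕊}

lemma apply_visitTime (hp : p ∈ recurrentSet i) (k : ℕ) : p (visitTime i k p) = i :=
  Nat.nth_mem_of_infinite (p := fun m => p m = i) hp k

lemma visitCount_visitTime (hp : p ∈ recurrentSet i) (k : ℕ) :
    visitCount (visitTime i k p) i p = k := by
  classical
  rw [visitCount_eq_count]
  exact Nat.count_nth_of_infinite (p := fun m => p m = i) hp k

lemma visitTime_visitCount {n : ℕ} (hn : p n = i) : visitTime i (visitCount n i p) p = n := by
  classical
  rw [visitCount_eq_count]
  exact Nat.nth_count (p := fun m => p m = i) hn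

lemma visitTime_strictMono (hp : p ∈ recurrentSet i) : StrictMono fun k => visitTime i k p :=
  Nat.nth_strictMono (p := fun m => p m = i) hp

lemma visitTime_eq_iff (hp : p ∈ recurrentSet i) {k n : ℕ} :
    visitTime i k p = n ↔ p n = i ∧ visitCount n i p = k := by
  constructor
  · rintro rfl
    exact ⟨apply_visitTime hp k, visitCount_visitTime hp k⟩
  · rintro ⟨h, rfl⟩
    exact visitTime_visitCount h

lemma tendsto_visitCount (hp : p ∈ recurrentSet i) :
    Tendsto (fun n => visitCount n i p) atTop atTop :=
  tendsto_atTop_atTop_of_monotone (visitCount_mono i p) fun k =>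
    ⟨visitTime i k p, (visitCount_visitTime hp k).ge⟩

/-- The reindexing of time exchanging the windows `[a, a + b)` and `[a + b, a + b + d)`. -/
def rotIdx (a b d m : ℕ) : ℕ :=
  if m < a then m else if m < a + d then m + b else if m < a + d + b then m - d else m

/-- The path obtained from `p` by exchanging the windows `[a, a + b)` and `[a + b, a + b + d)`. -/
def rot (a b d : ℕ) (p : ℕ → 𝕊) : ℕ → 𝕊 := fun m => p (rotIdx a b d m)

lemma rotIdx_rotIdx (a b d m : ℕ) : rotIdx a d b (rotIdx a b d m) = m := by
  unfold rotIdx; split_ifs <;> omega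

lemma rotIdx_le {a b d m N : ℕ} (hN : a + b + d ≤ N) (hm : m ≤ N) : rotIdx a b d m ≤ N := by
  unfold rotIdx; split_ifs <;> omega

lemma rot_rot (a b d : ℕ) (p : ℕ → 𝕊) : rot a d b (rot a b d p) = p :=
  funext fun m => congrArg p (rotIdx_rotIdx a d b m)

lemma rot_eq_iff {a b d N : ℕ} (hN : a + b + d ≤ N) {v : ℕ → 𝕊} :
    (∀ m ≤ N, rot a b d p m = v m) ↔ ∀ m ≤ N, p m = rot a d b v m := by
  constructor
  · intro h m hm
    have := h _ (rotIdx_le (a := a) (b := d) (d := b) (by omega) hm)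
    rwa [rot, rotIdx_rotIdx] at this
  · intro h m hm
    have := h _ (rotIdx_le hN hm)
    rwa [rot, rotIdx_rotIdx] at this

lemma rot_of_lt {a b d m : ℕ} (hm : m < a) : rot a b d p m = p m := by
  rw [rot, rotIdx, if_pos hm]

lemma rot_of_ge {a b d m : ℕ} (hm : a + b + d ≤ m) : rot a b d p m = p m := by
  rw [rot, rotIdx, if_neg (by omega), if_neg (by omega), if_neg (by omega)]

/-- The paths that are in `i` at times `a`, `a + b` and `a + b + d`. -/
def threeVisits (i : 𝕊) (a b d : ℕ) : Set (ℕ → 𝕊) :=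
  {p | p a = i ∧ p (a + b) = i ∧ p (a + b + d) = i}

variable {a b d : ℕ}

lemma rot_of_le (hp : p ∈ threeVisits i a b d) {m : ℕ} (hm : m ≤ a) :
    rot a b d p m = p m := by
  obtain ⟨h1, h2, h3⟩ := hp
  rcases hm.lt_or_eq with hm | rfl
  · exact rot_of_lt hm
  · simp only [rot, rotIdx]
    split_ifs with h4 h5 h6
    · rfl
    · rw [h1, h2]
    · rw [h1]; simp_all
    · rfl

lemma rot_add_left (hp : p ∈ threeVisits i a b d) {k : ℕ} (hk : k ≤ d) :
    rot a b d p (a + k) = p (a + b + k) := by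
  obtain ⟨h1, h2, h3⟩ := hp
  simp only [rot, rotIdx]
  rcases hk.lt_or_eq with hk | rfl
  · rw [if_neg (by omega), if_pos (by omega)]
    congr 1; omega
  · rw [if_neg (by omega), if_neg (by omega), h3]
    split_ifs with h
    · simpa using h1
    · obtain rfl : b = 0 := by omega
      simpa using h3

lemma rot_add_right (hp : p ∈ threeVisits i a b d) {k : ℕ} (hk : k ≤ b) :
    rot a b d p (a + d + k) = p (a + k) := by
  obtain ⟨h1, h2, h3⟩ := hp
  simp only [rot, rotIdx]
  rcases hk.lt_or_eq with hk | rfl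
  · rw [if_neg (by omega), if_neg (by omega), if_pos (by omega)]
    congr 1; omega
  · rw [if_neg (by omega), if_neg (by omega), if_neg (by omega), h2, ← h3]
    congr 1; omega

lemma rot_mem_threeVisits (hp : p ∈ threeVisits i a b d) :
    rot a b d p ∈ threeVisits i a d b := by
  refine ⟨?_, ?_, ?_⟩
  · rw [rot_of_le hp le_rfl, hp.1]
  · rw [rot_add_left hp le_rfl, hp.2.2]
  · rw [rot_add_right hp le_rfl, hp.2.1]

lemma transSum_add (f : 𝕊 → 𝕊 → ℕ) (n k : ℕ) (p : ℕ → 𝕊) :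
    transSum f (n + k) p = transSum f n p + transSum f k fun m => p (n + m) :=
  Finset.sum_range_add _ n k

lemma transSum_rot_left (hp : p ∈ threeVisits i a b d) (f : 𝕊 → 𝕊 → ℕ) :
    transSum f (a + d) (rot a b d p) + transSum f (a + b) p
      = transSum f a p + transSum f (a + b + d) p := by
  rw [transSum_add f a d, transSum_add f (a + b) d,
    transSum_congr (p := rot a b d p) (q := p) fun m hm => rot_of_le hp hm,
    transSum_congr (n := d) (q := fun m => p (a + b + m)) fun m hm => rot_add_left hp hm]
  ring

lemma transSum_rot (hp : p ∈ threeVisits i a b d) (f : 𝕊 → 𝕊 → ℕ) {n : ℕ}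
    (hn : a + b + d ≤ n) : transSum f n (rot a b d p) = transSum f n p := by
  obtain ⟨e, rfl⟩ := Nat.exists_eq_add_of_le hn
  have h1 := transSum_rot_left hp f
  have h2 := transSum_add f (a + d) b (rot a b d p)
  rw [transSum_congr (n := b) (q := fun m => p (a + m)) fun m hm => rot_add_right hp hm] at h2
  have h3 := transSum_add f a b p
  have h4 : a + b + d = a + d + b := by ring
  rw [transSum_add, transSum_add f _ e,
    transSum_congr (n := e) (q := fun m => p (a + b + d + m))
      fun m _ => rot_of_ge (by omega), h4]
  rw [h4] at h1
  omega

lemma visitCount_rot (hp : p ∈ threeVisits i a b d) (s : 𝕊) {n : ℕ}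
    (hn : a + b + d ≤ n) : visitCount n s (rot a b d p) = visitCount n s p := by
  classical
  simpa only [visitCount_eq_transSum] using transSum_rot hp _ hn

lemma transCount_rot (hp : p ∈ threeVisits i a b d) (s t : 𝕊) {n : ℕ}
    (hn : a + b + d ≤ n) : transCount n s t (rot a b d p) = transCount n s t p := by
  classical
  simpa only [transCount_eq_transSum] using transSum_rot hp _ hn

lemma visitCount_rot_left (hp : p ∈ threeVisits i a b d) (s : 𝕊) :
    visitCount (a + d) s (rot a b d p) + visitCount (a + b) s p
      = visitCount a s p + visitCount (a + b + d) s p := by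
  classical
  simpa only [visitCount_eq_transSum] using transSum_rot_left hp _

lemma mem_recurrentSet_iff_of_eventually_eq {q : ℕ → 𝕊} {N : ℕ} (h : ∀ m ≥ N, p m = q m) (s : 𝕊) :
    p ∈ recurrentSet s ↔ q ∈ recurrentSet s := by
  simp only [recurrentSet, Set.mem_ofPred_eq, ← Nat.frequently_atTop_iff_infinite]
  refine frequently_congr ?_
  filter_upwards [eventually_ge_atTop N] with m hm
  rw [h m hm]

lemma rot_mem_recurrentSet_iff (s : 𝕊) : rot a b d p ∈ recurrentSet s ↔ p ∈ recurrentSet s :=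
  mem_recurrentSet_iff_of_eventually_eq (fun _ hm => rot_of_ge hm) s

end Path

section BlockMove

variable {𝕊 : Type*} {i : 𝕊} {p : ℕ → 𝕊}

lemma visitTime_sub_eq_iff (hp : p ∈ recurrentSet i) {r k l a b d : ℕ} (hrk : r ≤ k)
    (hkl : k ≤ l) :
    (visitTime i r p, visitTime i k p - visitTime i r p, visitTime i l p - visitTime i k p)
        = (a, b, d) ↔
      p ∈ threeVisits i a b d ∧ visitCount a i p = r ∧ visitCount (a + b) i p = k ∧
        visitCount (a + b + d) i p = l := by
  have h1 := (visitTime_strictMono hp).monotone hrk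
  have h2 := (visitTime_strictMono hp).monotone hkl
  have h3 : (visitTime i r p, visitTime i k p - visitTime i r p,
      visitTime i l p - visitTime i k p) = (a, b, d) ↔
      visitTime i r p = a ∧ visitTime i k p = a + b ∧ visitTime i l p = a + b + d := by
    simp only [Prod.mk.injEq]; omega
  rw [h3, visitTime_eq_iff hp, visitTime_eq_iff hp, visitTime_eq_iff hp]
  simp only [threeVisits, Set.mem_ofPred_eq]
  tauto

/-- The path obtained from `p` by moving the excursion from `i` between the visits number `m`
and `m + 1` so that it starts at the visit number `r`. -/
noncomputable def blockMove (i : 𝕊) (r m : ℕ) (p : ℕ → 𝕊) : ℕ → 𝕊 :=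
  rot (visitTime i r p) (visitTime i m p - visitTime i r p)
    (visitTime i (m + 1) p - visitTime i m p) p

variable {r m : ℕ}

lemma visitTime_mem_threeVisits (hp : p ∈ recurrentSet i) (hrm : r ≤ m) :
    p ∈ threeVisits i (visitTime i r p) (visitTime i m p - visitTime i r p)
      (visitTime i (m + 1) p - visitTime i m p) :=
  ((visitTime_sub_eq_iff hp hrm m.le_succ).1 rfl).1

lemma visitTime_add_sub (hp : p ∈ recurrentSet i) (hrm : r ≤ m) :
    visitTime i r p + (visitTime i m p - visitTime i r p) = visitTime i m p :=
  Nat.add_sub_cancel' ((visitTime_strictMono hp).monotone hrm)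

lemma visitTime_add_sub_add_sub (hp : p ∈ recurrentSet i) (hrm : r ≤ m) :
    visitTime i r p + (visitTime i m p - visitTime i r p)
      + (visitTime i (m + 1) p - visitTime i m p) = visitTime i (m + 1) p := by
  rw [visitTime_add_sub hp hrm, visitTime_add_sub hp m.le_succ]

lemma blockMove_of_le (hp : p ∈ recurrentSet i) (hrm : r ≤ m) {n : ℕ}
    (hn : n ≤ visitTime i r p) : blockMove i r m p n = p n :=
  rot_of_le (visitTime_mem_threeVisits hp hrm) hn

lemma blockMove_add (hp : p ∈ recurrentSet i) (hrm : r ≤ m) {k : ℕ}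
    (hk : k ≤ visitTime i (m + 1) p - visitTime i m p) :
    blockMove i r m p (visitTime i r p + k) = p (visitTime i m p + k) := by
  rw [blockMove, rot_add_left (visitTime_mem_threeVisits hp hrm) hk, visitTime_add_sub hp hrm]

lemma visitCount_blockMove (hp : p ∈ recurrentSet i) (hrm : r ≤ m) (s : 𝕊) {n : ℕ}
    (hn : visitTime i (m + 1) p ≤ n) :
    visitCount n s (blockMove i r m p) = visitCount n s p :=
  visitCount_rot (visitTime_mem_threeVisits hp hrm) s (by rwa [visitTime_add_sub_add_sub hp hrm])

lemma transCount_blockMove (hp : p ∈ recurrentSet i) (hrm : r ≤ m) (s t : 𝕊) {n : ℕ}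
    (hn : visitTime i (m + 1) p ≤ n) :
    transCount n s t (blockMove i r m p) = transCount n s t p :=
  transCount_rot (visitTime_mem_threeVisits hp hrm) s t
    (by rwa [visitTime_add_sub_add_sub hp hrm])

lemma blockMove_mem_recurrentSet_iff (s : 𝕊) :
    blockMove i r m p ∈ recurrentSet s ↔ p ∈ recurrentSet s :=
  rot_mem_recurrentSet_iff s

lemma visitTime_blockMove_self (hp : p ∈ recurrentSet i) (hrm : r ≤ m) :
    visitTime i r (blockMove i r m p) = visitTime i r p := by
  rw [visitTime_eq_iff ((blockMove_mem_recurrentSet_iff i).2 hp), blockMove_of_le hp hrm le_rfl,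
    visitCount_congr fun n hn => blockMove_of_le hp hrm hn]
  exact ⟨apply_visitTime hp r, visitCount_visitTime hp r⟩

lemma visitTime_succ_blockMove (hp : p ∈ recurrentSet i) (hrm : r ≤ m) :
    visitTime i (r + 1) (blockMove i r m p)
      = visitTime i r p + (visitTime i (m + 1) p - visitTime i m p) := by
  have h := visitCount_rot_left (visitTime_mem_threeVisits hp hrm) i
  rw [visitTime_add_sub_add_sub hp hrm, visitTime_add_sub hp hrm, visitCount_visitTime hp,
    visitCount_visitTime hp, visitCount_visitTime hp] at h
  rw [visitTime_eq_iff ((blockMove_mem_recurrentSet_iff i).2 hp), blockMove_add hp hrm le_rfl,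
    visitTime_add_sub hp m.le_succ]
  refine ⟨apply_visitTime hp _, ?_⟩
  rw [blockMove]
  omega

end BlockMove

section Measurability

variable {𝕊 : Type*} [MeasurableSpace 𝕊]

lemma measurable_apply_of_measurable_index {τ : (ℕ → 𝕊) → ℕ} (hτ : Measurable τ) :
    Measurable fun p : ℕ → 𝕊 => p (τ p) := by
  have : Measurable fun x : ℕ × (ℕ → 𝕊) => x.2 x.1 :=
    measurable_from_prod_countable_right fun n => measurable_pi_apply n
  exact this.comp (hτ.prodMk measurable_id)

lemma measurable_rot (a b d : ℕ) : Measurable (rot a b d : (ℕ → 𝕊) → ℕ → 𝕊) :=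
  measurable_pi_lambda _ fun _ => measurable_pi_apply _

variable [MeasurableSingletonClass 𝕊]

lemma measurableSet_apply_eq (n : ℕ) (i : 𝕊) : MeasurableSet {p : ℕ → 𝕊 | p n = i} := by
  measurability

lemma measurableSet_recurrentSet (i : 𝕊) : MeasurableSet (recurrentSet i) := by
  have : recurrentSet i = ⋂ N : ℕ, ⋃ n : ℕ, ⋃ _ : N ≤ n, {p : ℕ → 𝕊 | p n = i} := by
    ext p
    simp [recurrentSet, ← Nat.frequently_atTop_iff_infinite, frequently_atTop]
  rw [this]
  exact .iInter fun N => .iUnion fun n => .iUnion fun _ => measurableSet_apply_eq n i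

lemma measurableSet_threeVisits (i : 𝕊) (a b d : ℕ) : MeasurableSet (threeVisits i a b d) :=
  (measurableSet_apply_eq _ i).inter
    ((measurableSet_apply_eq _ i).inter (measurableSet_apply_eq _ i))

variable [Countable 𝕊]

lemma measurable_transSum (f : 𝕊 → 𝕊 → ℕ) (n : ℕ) : Measurable (transSum f n) :=
  Finset.measurable_sum _ fun m _ =>
    (measurable_of_countable fun x : 𝕊 × 𝕊 => f x.1 x.2).comp
      (f := fun p : ℕ → 𝕊 => (p m, p (m + 1)))
      ((measurable_pi_apply m).prodMk (measurable_pi_apply (m + 1)))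

lemma measurable_visitCount (n : ℕ) (i : 𝕊) : Measurable (visitCount n i) := by
  classical
  rw [funext (visitCount_eq_transSum n i)]
  exact measurable_transSum _ n

lemma measurable_visitTime (i : 𝕊) (k : ℕ) : Measurable (visitTime i k) := by
  classical
  have hD (n : ℕ) : MeasurableSet {p : ℕ → 𝕊 | p n = i ∧ visitCount n i p = k} :=
    (measurableSet_apply_eq n i).inter (measurable_visitCount n i (measurableSet_singleton k))
  refine measurable_to_countable' fun n => ?_
  have h : visitTime i k ⁻¹' {n} = {p : ℕ → 𝕊 | p n = i ∧ visitCount n i p = k} ∪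
      if n = 0 then ⋂ n, {p : ℕ → 𝕊 | p n = i ∧ visitCount n i p = k}ᶜ else ∅ := by
    ext p
    by_cases hk : ∃ n, p n = i ∧ visitCount n i p = k
    · obtain ⟨n', hn', hk'⟩ := hk
      have h1 : visitTime i k p = n' := hk' ▸ visitTime_visitCount hn'
      have h2 : p ∉ (if n = 0 then ⋂ n, {p : ℕ → 𝕊 | p n = i ∧ visitCount n i p = k}ᶜ else ∅) := by
        split_ifs
        · simp only [Set.mem_iInter, not_forall]
          exact ⟨n', by simp [hn', hk']⟩
        · simp
      simp only [Set.mem_preimage, Set.mem_singleton_iff, Set.mem_union, h2, or_false, h1]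
      constructor
      · rintro rfl
        exact ⟨hn', hk'⟩
      · rintro ⟨hn, hk⟩
        rw [← h1, ← hk, visitTime_visitCount hn]
    · have h1 : visitTime i k p = 0 := by
        by_contra h0
        refine hk ⟨visitTime i k p, Nat.nth_mem_of_ne_zero h0, ?_⟩
        rw [visitCount_eq_count]
        refine Nat.count_nth fun hf => ?_
        by_contra hlt
        exact h0 (Nat.nth_of_card_le hf (not_lt.1 hlt))
      simp only [Set.mem_preimage, Set.mem_singleton_iff, Set.mem_union, h1]
      split_ifs with h0
      · simp_all
      · have : ¬ (p n = i ∧ visitCount n i p = k) := fun h => hk ⟨n, h⟩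
        simp [this, Ne.symm h0]
  rw [h]
  refine (hD n).union ?_
  split_ifs
  · exact .iInter fun n => (hD n).compl
  · exact .empty

lemma measurable_blockMove (i : 𝕊) (r m : ℕ) : Measurable (blockMove i r m) := by
  refine measurable_pi_lambda _ fun n => measurable_apply_of_measurable_index ?_
  exact (measurable_of_countable fun x : ℕ × ℕ × ℕ => rotIdx x.1 x.2.1 x.2.2 n).comp
    ((measurable_visitTime i r).prodMk
      (((measurable_visitTime i m).sub (measurable_visitTime i r)).prodMk
        ((measurable_visitTime i (m + 1)).sub (measurable_visitTime i m))))

end Measurability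

section Invariance

variable {𝕊 : Type*}

/-- The paths that follow `v` up to time `n`. -/
def prefixSet (n : ℕ) (v : ℕ → 𝕊) : Set (ℕ → 𝕊) := {p | ∀ m ≤ n, p m = v m}

/-- The data (start, length of the first window, length of the second window) attached to the
visits to `i` with numbers `r ≤ k ≤ l`. -/
noncomputable def windows (i : 𝕊) (r k l : ℕ) (p : ℕ → 𝕊) : ℕ × ℕ × ℕ :=
  (visitTime i r p, visitTime i k p - visitTime i r p, visitTime i l p - visitTime i k p)

lemma windows_rot_iff {i : 𝕊} {p : ℕ → 𝕊} (hp : p ∈ recurrentSet i) {r m a b d : ℕ}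
    (hrm : r ≤ m) (h3 : p ∈ threeVisits i a b d) :
    windows i r (r + 1) (m + 1) (rot a b d p) = (a, d, b) ↔
      windows i r m (m + 1) p = (a, b, d) := by
  rw [windows, windows, visitTime_sub_eq_iff hp hrm m.le_succ,
    visitTime_sub_eq_iff ((rot_mem_recurrentSet_iff i).2 hp) r.le_succ (by omega),
    visitCount_congr (q := p) fun n hn => rot_of_le h3 hn,
    visitCount_rot (n := a + d + b) h3 i (by omega)]
  have h4 := visitCount_rot_left h3 i
  have h5 : a + d + b = a + b + d := by omega
  rw [h5]
  simp only [h3, rot_mem_threeVisits h3, true_and]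
  omega

lemma measure_prefixSet_rot [MeasurableSpace 𝕊] {ν : Measure (ℕ → 𝕊)}
    (hν : MarkovExchangeable ν fun n p => p n) {i : 𝕊} {a b d n : ℕ}
    (hn : a + b + d ≤ n) {v : ℕ → 𝕊} (hv : v ∈ threeVisits i a b d) :
    ν (prefixSet n (rot a b d v)) = ν (prefixSet n v) :=
  hν n _ _ (rot_of_le hv (Nat.zero_le _)) fun s t =>
    transCount_rot hv s t hn

variable [MeasurableSpace 𝕊] [MeasurableSingletonClass 𝕊]

lemma measurableSet_prefixSet (n : ℕ) (v : ℕ → 𝕊) : MeasurableSet (prefixSet n v) := by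
  have : prefixSet n v = ⋂ m : ℕ, ⋂ _ : m ≤ n, {p : ℕ → 𝕊 | p m = v m} := by
    ext p; simp [prefixSet]
  rw [this]
  exact .iInter fun m => .iInter fun _ => measurableSet_apply_eq m _

variable [Countable 𝕊]

lemma measure_ext_of_prefixSet {ν₁ ν₂ : Measure (ℕ → 𝕊)} [IsFiniteMeasure ν₁]
    [IsFiniteMeasure ν₂] (N : ℕ)
    (h : ∀ n ≥ N, ∀ v, ν₁ (prefixSet n v) = ν₂ (prefixSet n v)) : ν₁ = ν₂ := by
  have hfam : IsProjectiveMeasureFamily fun I : Finset ℕ => ν₂.map I.restrict := by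
    intro I J hJI
    rw [Measure.map_map (Finset.measurable_restrict₂ _) (Finset.measurable_restrict _)]
    rfl
  have h₂ : IsProjectiveLimit ν₂ fun I : Finset ℕ => ν₂.map I.restrict := fun _ => rfl
  refine IsProjectiveLimit.unique ((isProjectiveLimit_nat_iff' hfam ν₁ N).2 fun n hn => ?_) h₂
  refine Measure.ext_of_singleton fun x => ?_
  rw [Measure.map_apply (by fun_prop) (measurableSet_singleton x),
    Measure.map_apply (by fun_prop) (measurableSet_singleton x)]
  by_cases hx : ∃ v : ℕ → 𝕊, Preorder.frestrictLe n v = x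
  · obtain ⟨v, rfl⟩ := hx
    have hpre : Preorder.frestrictLe (π := fun _ => 𝕊) n ⁻¹' {Preorder.frestrictLe n v}
        = prefixSet n v := by
      ext p
      simp [prefixSet, funext_iff]
    have hpre' : (Finset.Iic n).restrict (π := fun _ => 𝕊) ⁻¹' {Preorder.frestrictLe n v}
        = prefixSet n v := hpre
    rw [hpre, hpre']
    exact h n hn v
  · have hpre : Preorder.frestrictLe (π := fun _ => 𝕊) n ⁻¹' {x} = ∅ := by
      ext p
      simpa using fun hp => hx ⟨p, hp⟩
    have hpre' : (Finset.Iic n).restrict (π := fun _ => 𝕊) ⁻¹' {x} = ∅ := hpre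
    rw [hpre, hpre', measure_empty, measure_empty]

variable {ν : Measure (ℕ → 𝕊)} [IsFiniteMeasure ν]

lemma map_rot_restrict_threeVisits (hν : MarkovExchangeable ν fun n p => p n) (i : 𝕊)
    (a b d : ℕ) :
    (ν.restrict (threeVisits i a b d)).map (rot a b d) = ν.restrict (threeVisits i a d b) := by
  have := (measurable_rot (𝕊 := 𝕊) a b d)
  refine measure_ext_of_prefixSet (a + b + d) fun n hn v => ?_
  rw [Measure.map_apply this (measurableSet_prefixSet n v),
    Measure.restrict_apply (this (measurableSet_prefixSet n v)),
    Measure.restrict_apply (measurableSet_prefixSet n v)]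
  have hpre : rot a b d ⁻¹' prefixSet n v = prefixSet n (rot a d b v) := by
    ext p
    exact rot_eq_iff hn
  rw [hpre]
  by_cases hv : v ∈ threeVisits i a d b
  · have hv' := rot_mem_threeVisits hv
    have h1 : prefixSet n (rot a d b v) ∩ threeVisits i a b d = prefixSet n (rot a d b v) := by
      refine Set.inter_eq_left.2 fun p hp => ?_
      exact ⟨(hp _ (by omega)).trans hv'.1, (hp _ (by omega)).trans hv'.2.1,
        (hp _ (by omega)).trans hv'.2.2⟩
    have h2 : prefixSet n v ∩ threeVisits i a d b = prefixSet n v := by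
      refine Set.inter_eq_left.2 fun p hp => ?_
      exact ⟨(hp _ (by omega)).trans hv.1, (hp _ (by omega)).trans hv.2.1,
        (hp _ (by omega)).trans hv.2.2⟩
    rw [h1, h2, measure_prefixSet_rot hν (by omega) hv]
  · have h1 : prefixSet n (rot a d b v) ∩ threeVisits i a b d = ∅ := by
      refine Set.eq_empty_of_forall_notMem fun p ⟨hp, hp'⟩ => hv ?_
      have hv' : rot a d b v ∈ threeVisits i a b d :=
        ⟨(hp _ (by omega)).symm.trans hp'.1, (hp _ (by omega)).symm.trans hp'.2.1,
          (hp _ (by omega)).symm.trans hp'.2.2⟩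
      simpa only [rot_rot] using rot_mem_threeVisits hv'
    have h2 : prefixSet n v ∩ threeVisits i a d b = ∅ := by
      refine Set.eq_empty_of_forall_notMem fun p ⟨hp, hp'⟩ => hv ?_
      exact ⟨(hp _ (by omega)).symm.trans hp'.1, (hp _ (by omega)).symm.trans hp'.2.1,
          (hp _ (by omega)).symm.trans hp'.2.2⟩
    rw [h1, h2]

lemma lintegral_eq_tsum_fiber {α β : Type*} [MeasurableSpace α] [Countable β]
    [MeasurableSpace β] [MeasurableSingletonClass β] (ρ : Measure α) {s : Set α}
    (hs : MeasurableSet s) {g : α → β} (hg : Measurable g) (F : α → ℝ≥0∞) :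
    ∫⁻ x in s, F x ∂ρ = ∑' y, ∫⁻ x in s ∩ g ⁻¹' {y}, F x ∂ρ := by
  rw [← lintegral_iUnion (fun y => hs.inter (hg (measurableSet_singleton y)))]
  · congr 2
    ext x; simp
  · exact fun y z hyz => (Set.disjoint_singleton.2 hyz |>.preimage g).mono
      Set.inter_subset_right Set.inter_subset_right

lemma measurable_windows (i : 𝕊) (r k l : ℕ) : Measurable (windows i r k l) :=
  (measurable_visitTime i r).prodMk
      (((measurable_visitTime i k).sub (measurable_visitTime i r)).prodMk
        ((measurable_visitTime i l).sub (measurable_visitTime i k)))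

lemma lintegral_comp_blockMove (hν : MarkovExchangeable ν fun n p => p n) (i : 𝕊) {r m : ℕ}
    (hrm : r ≤ m) {F : (ℕ → 𝕊) → ℝ≥0∞} (hF : Measurable F) :
    ∫⁻ p in recurrentSet i, F (blockMove i r m p) ∂ν = ∫⁻ p in recurrentSet i, F p ∂ν := by
  have hI := measurableSet_recurrentSet i
  rw [lintegral_eq_tsum_fiber ν hI (measurable_windows i r m (m + 1)),
    lintegral_eq_tsum_fiber ν hI (measurable_windows i r (r + 1) (m + 1)),
    ← Equiv.tsum_eq ((Equiv.refl ℕ).prodCongr (Equiv.prodComm ℕ ℕ))]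
  refine tsum_congr fun ⟨a, d, b⟩ => ?_
  change ∫⁻ p in recurrentSet i ∩ windows i r m (m + 1) ⁻¹' {(a, b, d)}, _ ∂ν = _
  set D := recurrentSet i ∩ windows i r m (m + 1) ⁻¹' {(a, b, d)} with hD_def
  set D' := recurrentSet i ∩ windows i r (r + 1) (m + 1) ⁻¹' {(a, d, b)} with hD'_def
  have hD : MeasurableSet D :=
    hI.inter (measurable_windows i r m (m + 1) (measurableSet_singleton _))
  have hD' : MeasurableSet D' :=
    hI.inter (measurable_windows i r (r + 1) (m + 1) (measurableSet_singleton _))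
  have hsub : D ⊆ threeVisits i a b d := fun p hp =>
    ((visitTime_sub_eq_iff hp.1 hrm m.le_succ).1 hp.2).1
  have hsubset : D' ⊆ threeVisits i a d b := fun p hp =>
    ((visitTime_sub_eq_iff hp.1 r.le_succ (by omega)).1 hp.2).1
  calc ∫⁻ p in D, F (blockMove i r m p) ∂ν
      = ∫⁻ p in D, F (rot a b d p) ∂ν := by
        refine setLIntegral_congr_fun hD fun p hp => ?_
        have h : windows i r m (m + 1) p = (a, b, d) := hp.2
        simp only [windows, Prod.mk.injEq] at h
        obtain ⟨h1, h2, h3⟩ := h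
        simp only [blockMove, h2, h3]
        rw [h1]
    _ = ∫⁻ p in threeVisits i a b d, D.indicator (fun p => F (rot a b d p)) p ∂ν := by
        rw [lintegral_indicator hD, Measure.restrict_restrict hD, Set.inter_eq_left.2 hsub]
    _ = ∫⁻ p in threeVisits i a b d, D'.indicator F (rot a b d p) ∂ν := by
        refine setLIntegral_congr_fun (measurableSet_threeVisits i a b d) fun p hp => ?_
        have hiff : rot a b d p ∈ D' ↔ p ∈ D := by
          simp only [D, D', Set.mem_inter_iff, rot_mem_recurrentSet_iff]
          exact and_congr_right fun hI => windows_rot_iff hI hrm hp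
        by_cases h : p ∈ D
        · simp only [Set.indicator_of_mem h, Set.indicator_of_mem (hiff.2 h)]
        · simp only [Set.indicator_of_notMem h, Set.indicator_of_notMem (mt hiff.1 h)]
    _ = ∫⁻ p in threeVisits i a d b, D'.indicator F p ∂ν := by
        rw [← map_rot_restrict_threeVisits hν i a b d,
          lintegral_map (hF.indicator hD') (measurable_rot a b d)]
    _ = ∫⁻ p in D', F p ∂ν := by
        rw [lintegral_indicator hD', Measure.restrict_restrict hD', Set.inter_eq_left.2 hsubset]

/-- Moving an excursion preserves the law of a Markov exchangeable process. -/
lemma measurePreserving_blockMove (hν : MarkovExchangeable ν fun n p => p n) (i : 𝕊) {r m : ℕ}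
    (hrm : r ≤ m) :
    MeasurePreserving (blockMove i r m) (ν.restrict (recurrentSet i))
      (ν.restrict (recurrentSet i)) := by
  refine ⟨measurable_blockMove i r m, Measure.ext fun s hs => ?_⟩
  have := lintegral_comp_blockMove hν i hrm (F := s.indicator 1) (measurable_one.indicator hs)
  rwa [← lintegral_map (measurable_one.indicator hs) (measurable_blockMove i r m),
    lintegral_indicator_one hs, lintegral_indicator_one hs] at this

end Invariance

section Recurrence

variable {𝕊 : Type*} {i : 𝕊} {p : ℕ → 𝕊}

lemma exists_visitTime_le_lt (hp : p ∈ recurrentSet i) (h0 : p 0 = i) (t : ℕ) :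
    ∃ m, visitTime i m p ≤ t ∧ t < visitTime i (m + 1) p := by
  have hlt := visitTime_strictMono hp
  induction t with
  | zero =>
    have h : visitTime i 0 p = 0 :=
      (visitTime_eq_iff hp).2 ⟨h0, by simp [visitCount]⟩
    have h1 : visitTime i 0 p < visitTime i (0 + 1) p := hlt Nat.zero_lt_one
    exact ⟨0, h.le, by omega⟩
  | succ t ih =>
    obtain ⟨m, h1, h2⟩ := ih
    rcases (Nat.succ_le_of_lt h2).lt_or_eq with h | h
    · exact ⟨m, by omega, h⟩
    · have h3 : visitTime i (m + 1) p < visitTime i (m + 1 + 1) p := hlt (Nat.lt_succ_self _)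
      exact ⟨m + 1, by omega, by omega⟩

/-- The paths whose excursion from `i` following the visit number `m` meets the state `s`. -/
def hitSet (i s : 𝕊) (m : ℕ) : Set (ℕ → 𝕊) :=
  {p | ∃ k, k < visitTime i (m + 1) p - visitTime i m p ∧ p (visitTime i m p + k) = s}

lemma blockMove_mem_hitSet_iff (hp : p ∈ recurrentSet i) (s : 𝕊) {r m : ℕ} (hrm : r ≤ m) :
    blockMove i r m p ∈ hitSet i s r ↔ p ∈ hitSet i s m := by
  simp only [hitSet, Set.mem_ofPred_eq, visitTime_blockMove_self hp hrm,
    visitTime_succ_blockMove hp hrm, Nat.add_sub_cancel_left]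
  refine exists_congr fun k => and_congr_right fun hk => ?_
  rw [blockMove_add hp hrm hk.le]

variable [MeasurableSpace 𝕊] [MeasurableSingletonClass 𝕊] [Countable 𝕊]

lemma measurableSet_hitSet (i s : 𝕊) (m : ℕ) : MeasurableSet (hitSet i s m) := by
  have : hitSet i s m = ⋃ k : ℕ, {p | k < visitTime i (m + 1) p - visitTime i m p} ∩
      (fun p : ℕ → 𝕊 => p (visitTime i m p + k)) ⁻¹' {s} := by
    ext p; simp [hitSet]
  rw [this]
  exact .iUnion fun k => (measurableSet_lt measurable_const
    ((measurable_visitTime i (m + 1)).sub (measurable_visitTime i m))).inter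
    (measurable_apply_of_measurable_index ((measurable_visitTime i m).add_const k)
      (measurableSet_singleton s))

variable {ν : Measure (ℕ → 𝕊)} [IsFiniteMeasure ν]

lemma measure_hitSet_inter_compl (hν : MarkovExchangeable ν fun n p => p n) (i s : 𝕊) (m : ℕ) :
    ν (hitSet i s m ∩ (recurrentSet s)ᶜ ∩ recurrentSet i) = 0 := by
  have hI := measurableSet_recurrentSet i
  have hE (m : ℕ) : MeasurableSet (hitSet i s m ∩ (recurrentSet s)ᶜ) :=
    (measurableSet_hitSet i s m).inter (measurableSet_recurrentSet s).compl
  have hconst (m : ℕ) : ν (hitSet i s m ∩ (recurrentSet s)ᶜ ∩ recurrentSet i)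
      = ν (hitSet i s 0 ∩ (recurrentSet s)ᶜ ∩ recurrentSet i) := by
    have h := (measurePreserving_blockMove hν i m.zero_le).measure_preimage (hE 0).nullMeasurableSet
    rw [Measure.restrict_apply (hE 0), Measure.restrict_apply' hI] at h
    rw [← h]
    congr 1
    ext p
    simp only [Set.mem_inter_iff, Set.mem_preimage, Set.mem_compl_iff,
      blockMove_mem_recurrentSet_iff]
    refine and_congr_left fun hp => and_congr_left fun _ => ?_
    exact (blockMove_mem_hitSet_iff hp s m.zero_le).symm
  have hlim := tendsto_measure_of_tendsto_indicator_of_isFiniteMeasure (A := ∅) atTop ν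
    (fun m => (hE m).inter hI) fun p => by
      by_cases hp : p ∈ recurrentSet s ∨ p ∉ recurrentSet i
      · refine Eventually.of_forall fun m => ?_
        simp only [Set.mem_inter_iff, Set.mem_compl_iff, Set.mem_empty_iff_false]
        tauto
      push Not at hp
      obtain ⟨N, hN⟩ := (Set.not_infinite.1 hp.1).bddAbove
      filter_upwards [eventually_gt_atTop N] with m hm
      simp only [Set.mem_inter_iff, Set.mem_empty_iff_false, iff_false]
      rintro ⟨⟨⟨k, -, hk⟩, -⟩, -⟩
      have h1 := hN hk
      have h2 := (visitTime_strictMono hp.2).le_apply (x := m)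
      omega
  rw [hconst, ← measure_empty (μ := ν)]
  exact tendsto_nhds_unique (tendsto_const_nhds.congr fun m => (hconst m).symm) hlim

/-- Almost surely, every visited state is visited infinitely often. -/
lemma ae_mem_recurrentSet_of_visited (hν : MarkovExchangeable ν fun n p => p n) {x₀ : 𝕊}
    (h0 : ∀ᵐ p ∂ν, p 0 = x₀) (hrec : ∀ᵐ p ∂ν, p ∈ recurrentSet x₀) :
    ∀ᵐ p ∂ν, ∀ n, p ∈ recurrentSet (p n) := by
  have h : ∀ᵐ p ∂ν, ∀ s m, p ∉ hitSet x₀ s m ∩ (recurrentSet s)ᶜ ∩ recurrentSet x₀ :=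
    ae_all_iff.2 fun s => ae_all_iff.2 fun m =>
      measure_eq_zero_iff_ae_notMem.1 (measure_hitSet_inter_compl hν x₀ s m)
  filter_upwards [h0, hrec, h] with p h0 hrec h n
  obtain ⟨m, h1, h2⟩ := exists_visitTime_le_lt hrec h0 n
  by_contra hn
  exact h (p n) m ⟨⟨⟨n - visitTime x₀ m p, by omega, by rw [Nat.add_sub_cancel' h1]⟩, hn⟩, hrec⟩

end Recurrence

section SuccCount

variable {𝕊 : Type*}

/-- The indicator that the visit number `k` to `i` is followed by a transition to `j`. -/
noncomputable def succInd (i j : 𝕊) (k : ℕ) (p : ℕ → 𝕊) : ℝ :=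
  ({j} : Set 𝕊).indicator 1 (p (visitTime i k p + 1))

/-- The number of the first `l` visits to `i` that are followed by a transition to `j`. -/
noncomputable def succCount (i j : 𝕊) (l : ℕ) (p : ℕ → 𝕊) : ℝ :=
  ∑ k ∈ Finset.range l, succInd i j k p

variable {i j : 𝕊} {p : ℕ → 𝕊}

lemma succInd_nonneg (i j : 𝕊) (k : ℕ) (p : ℕ → 𝕊) : 0 ≤ succInd i j k p :=
  Set.indicator_nonneg (fun _ _ => zero_le_one) _

lemma succInd_le_one (i j : 𝕊) (k : ℕ) (p : ℕ → 𝕊) : succInd i j k p ≤ 1 :=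
  Set.indicator_le_self' (fun _ _ => zero_le_one) _

lemma succCount_succ (i j : 𝕊) (l : ℕ) (p : ℕ → 𝕊) :
    succCount i j (l + 1) p = succCount i j l p + succInd i j l p :=
  Finset.sum_range_succ _ _

lemma succCount_nonneg (i j : 𝕊) (l : ℕ) (p : ℕ → 𝕊) : 0 ≤ succCount i j l p :=
  Finset.sum_nonneg fun k _ => succInd_nonneg i j k p

lemma succCount_mono (i j : 𝕊) (p : ℕ → 𝕊) : Monotone fun l => succCount i j l p :=
  monotone_nat_of_le_succ fun l => by
    rw [succCount_succ]; exact le_add_of_nonneg_right (succInd_nonneg i j l p)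

lemma succCount_le (i j : 𝕊) (l : ℕ) (p : ℕ → 𝕊) : succCount i j l p ≤ l :=
  (Finset.sum_le_sum fun k _ => succInd_le_one i j k p).trans_eq (by simp)

lemma transCount_eq_succCount (n : ℕ) (i j : 𝕊) (p : ℕ → 𝕊) :
    (transCount n i j p : ℝ) = succCount i j (visitCount n i p) p := by
  classical
  induction n with
  | zero => simp [transCount, visitCount, succCount]
  | succ n ih =>
    rw [transCount_succ, visitCount_succ]
    by_cases hn : p n = i
    · rw [if_pos hn, succCount_succ, ← ih, succInd, visitTime_visitCount hn]
      simp [hn, Set.indicator_apply]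
    · simp [hn, ih]

lemma succInd_blockMove (hp : p ∈ recurrentSet i) (j : 𝕊) {r m : ℕ} (hrm : r ≤ m) :
    succInd i j r (blockMove i r m p) = succInd i j m p := by
  have h : visitTime i m p < visitTime i (m + 1) p := visitTime_strictMono hp m.lt_succ_self
  rw [succInd, succInd, visitTime_blockMove_self hp hrm, blockMove_add hp hrm (by omega)]

lemma succCount_blockMove (hp : p ∈ recurrentSet i) (j : 𝕊) {r m l : ℕ} (hrm : r ≤ m)
    (hl : m < l) : succCount i j l (blockMove i r m p) = succCount i j l p := by
  have h : visitTime i (m + 1) p ≤ visitTime i l p := (visitTime_strictMono hp).monotone hl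
  have h1 := transCount_eq_succCount (visitTime i l p) i j p
  have h2 := transCount_eq_succCount (visitTime i l p) i j (blockMove i r m p)
  rw [visitCount_visitTime hp] at h1
  rw [visitCount_blockMove hp hrm i h, transCount_blockMove hp hrm i j h,
    visitCount_visitTime hp] at h2
  rw [← h1, ← h2]

variable [MeasurableSpace 𝕊] [MeasurableSingletonClass 𝕊] [Countable 𝕊]

@[fun_prop]
lemma measurable_succInd (i j : 𝕊) (k : ℕ) : Measurable (succInd i j k) :=
  (measurable_const.indicator (measurableSet_singleton j)).comp
    (measurable_apply_of_measurable_index ((measurable_visitTime i k).add_const 1))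

@[fun_prop]
lemma measurable_succCount (i j : 𝕊) (l : ℕ) : Measurable (succCount i j l) :=
  Finset.measurable_fun_sum _ fun k _ => measurable_succInd i j k

variable {ν : Measure (ℕ → 𝕊)} [IsFiniteMeasure ν]

lemma setIntegral_succInd_mul (hν : MarkovExchangeable ν fun n p => p n) (i j : 𝕊) {r m : ℕ}
    (hrm : r ≤ m) {H : (ℕ → 𝕊) → ℝ} (hH : Measurable H)
    (hinv : ∀ p ∈ recurrentSet i, H (blockMove i r m p) = H p) :
    ∫ p in recurrentSet i, succInd i j r p * H p ∂ν
      = ∫ p in recurrentSet i, succInd i j m p * H p ∂ν := by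
  have hmp := measurePreserving_blockMove hν i hrm
  have h := integral_map (f := fun p => succInd i j r p * H p) hmp.aemeasurable
    ((measurable_succInd i j r).mul hH).aestronglyMeasurable
  rw [hmp.map_eq] at h
  rw [h]
  refine setIntegral_congr_fun (measurableSet_recurrentSet i) fun p hp => ?_
  simp only [hinv p hp, succInd_blockMove hp j hrm]

end SuccCount
lemma integrable_of_nonneg_of_le_one {α : Type*} [MeasurableSpace α] {κ : Measure α}
    [IsFiniteMeasure κ] {f : α → ℝ} (hf : Measurable f) (h0 : ∀ p, 0 ≤ f p) (h1 : ∀ p, f p ≤ 1) :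
    Integrable f κ :=
  .of_bound hf.aestronglyMeasurable 1 <| ae_of_all _ fun p => by
    rw [Real.norm_of_nonneg (h0 p)]; exact h1 p

section Convergence

variable {𝕊 : Type*} {i j : 𝕊} {p : ℕ → 𝕊}

/-- The fraction of the first `l` visits to `i` that are followed by a transition to `j`. -/
noncomputable def succAvg (i j : 𝕊) (l : ℕ) (p : ℕ → 𝕊) : ℝ := succCount i j l p / l

lemma succAvg_nonneg (i j : 𝕊) (l : ℕ) (p : ℕ → 𝕊) : 0 ≤ succAvg i j l p :=
  div_nonneg (succCount_nonneg i j l p) l.cast_nonneg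

lemma succAvg_le_one (i j : 𝕊) (l : ℕ) (p : ℕ → 𝕊) : succAvg i j l p ≤ 1 :=
  div_le_one_of_le₀ (succCount_le i j l p) l.cast_nonneg

lemma abs_succAvg_sub_succ_le (i j : 𝕊) (l : ℕ) (p : ℕ → 𝕊) :
    |succAvg i j l p - succAvg i j (l + 1) p| ≤ 1 / ((l : ℝ) + 1) := by
  have hl : (0 : ℝ) < l + 1 := by positivity
  have h : succAvg i j l p * l = succCount i j l p := by
    rcases eq_or_ne l 0 with rfl | h
    · simp [succCount]
    · exact div_mul_cancel₀ _ (by exact_mod_cast h)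
  have h' : succAvg i j (l + 1) p
      = (succAvg i j l p * l + succInd i j l p) / (l + 1) := by
    rw [h, succAvg, succCount_succ]; push_cast; rfl
  have h'' : succAvg i j l p - succAvg i j (l + 1) p
      = (succAvg i j l p - succInd i j l p) / (l + 1) := by
    rw [h']; field_simp; ring
  rw [h'', abs_div, abs_of_pos hl]
  gcongr
  rw [abs_le]
  constructor <;> linarith [succAvg_nonneg i j l p, succAvg_le_one i j l p,
    succInd_nonneg i j l p, succInd_le_one i j l p]

lemma tendsto_succAvg_of_tendsto_pow {a : ℝ}
    (h : Tendsto (fun n : ℕ => succAvg i j ((n + 1) ^ 4) p) atTop (𝓝 a)) :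
    Tendsto (fun l => succAvg i j l p) atTop (𝓝 a) := by
  refine tendsto_div_of_monotone_of_exists_subseq_tendsto_div (fun l => succCount i j l p) a
    (succCount_mono i j p) fun b hb => ⟨fun n => (n + 1) ^ 4, ?_, ?_, h⟩
  · have hlim : Tendsto (fun n : ℕ => (1 + 1 / ((n : ℝ) + 1)) ^ 4) atTop (𝓝 1) := by
      simpa using (tendsto_one_div_add_atTop_nhds_zero_nat.const_add (1 : ℝ)).pow 4
    filter_upwards [hlim.eventually_le_const hb] with n hn
    have h1 : (0 : ℝ) < (n : ℝ) + 1 := by positivity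
    have h2 : ((n : ℝ) + 1 + 1) ^ 4 = (1 + 1 / ((n : ℝ) + 1)) ^ 4 * ((n : ℝ) + 1) ^ 4 := by
      rw [← mul_pow]; congr 1; field_simp
    push_cast
    rw [h2]
    gcongr
  · exact tendsto_atTop_mono (fun n => (Nat.le_succ n).trans (Nat.le_self_pow (by norm_num) _))
      tendsto_id

variable [MeasurableSpace 𝕊] [MeasurableSingletonClass 𝕊] [Countable 𝕊]

@[fun_prop]
lemma measurable_succAvg (i j : 𝕊) (l : ℕ) : Measurable (succAvg i j l) :=
  (measurable_succCount i j l).div_const _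

variable {ν : Measure (ℕ → 𝕊)} [IsProbabilityMeasure ν]

lemma setIntegral_succAvg_mul_succAvg (hν : MarkovExchangeable ν fun n p => p n) (i j : 𝕊)
    {k l : ℕ} (hk : k ≠ 0) (hkl : k ≤ l) :
    ∫ p in recurrentSet i, succAvg i j k p * succAvg i j l p ∂ν
      = ∫ p in recurrentSet i, succInd i j 0 p * succAvg i j l p ∂ν := by
  have h (m : ℕ) (hm : m ∈ Finset.range k) :
      ∫ p in recurrentSet i, succInd i j m p * succAvg i j l p ∂ν
        = ∫ p in recurrentSet i, succInd i j 0 p * succAvg i j l p ∂ν :=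
    (setIntegral_succInd_mul hν i j m.zero_le (measurable_succAvg i j l) fun p hp => by
      rw [succAvg, succCount_blockMove hp j m.zero_le
        ((Finset.mem_range.1 hm).trans_le hkl), succAvg]).symm
  have h1 (p : ℕ → 𝕊) : succAvg i j k p * succAvg i j l p
      = (k : ℝ)⁻¹ * ∑ m ∈ Finset.range k, succInd i j m p * succAvg i j l p := by
    rw [← Finset.sum_mul, succAvg, succCount]; ring
  simp_rw [h1]
  rw [integral_const_mul, integral_finsetSum, Finset.sum_congr rfl h]
  · simp [hk]
  · exact fun m _ => integrable_of_nonneg_of_le_one (by fun_prop)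
      (fun p => mul_nonneg (succInd_nonneg i j m p) (succAvg_nonneg i j l p))
      (fun p => mul_le_one₀ (succInd_le_one i j m p) (succAvg_nonneg i j l p)
        (succAvg_le_one i j l p))

lemma setIntegral_succAvg_sub_sq (hν : MarkovExchangeable ν fun n p => p n) (i j : 𝕊)
    {k l : ℕ} (hk : k ≠ 0) (hkl : k ≤ l) :
    ∫ p in recurrentSet i, (succAvg i j k p - succAvg i j l p) ^ 2 ∂ν
      = ∫ p in recurrentSet i, succInd i j 0 p * succAvg i j k p ∂ν
        - ∫ p in recurrentSet i, succInd i j 0 p * succAvg i j l p ∂ν := by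
  have hint (a b : ℕ) : Integrable (fun p => succAvg i j a p * succAvg i j b p)
      (ν.restrict (recurrentSet i)) :=
    integrable_of_nonneg_of_le_one (by fun_prop)
      (fun p => mul_nonneg (succAvg_nonneg i j a p) (succAvg_nonneg i j b p))
      (fun p => mul_le_one₀ (succAvg_le_one i j a p) (succAvg_nonneg i j b p)
        (succAvg_le_one i j b p))
  have h (p : ℕ → 𝕊) : (succAvg i j k p - succAvg i j l p) ^ 2
      = succAvg i j k p * succAvg i j k p
        - 2 * (succAvg i j k p * succAvg i j l p) + succAvg i j l p * succAvg i j l p := by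
    ring
  simp_rw [h]
  have hsub : Integrable (fun p => succAvg i j k p * succAvg i j k p
      - 2 * (succAvg i j k p * succAvg i j l p)) (ν.restrict (recurrentSet i)) :=
    (hint k k).sub ((hint k l).const_mul 2)
  rw [integral_add hsub (hint l l),
    integral_sub (hint k k) ((hint k l).const_mul 2), integral_const_mul,
    setIntegral_succAvg_mul_succAvg hν i j hk le_rfl,
    setIntegral_succAvg_mul_succAvg hν i j hk hkl,
    setIntegral_succAvg_mul_succAvg hν i j (by omega : l ≠ 0) le_rfl]
  ring

lemma setIntegral_succAvg_sub_sq_le (hν : MarkovExchangeable ν fun n p => p n) (i j : 𝕊)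
    {k l : ℕ} (hkl : k ≤ l) :
    ∫ p in recurrentSet i, (succAvg i j (k + 1) p - succAvg i j (l + 1) p) ^ 2 ∂ν
      ≤ 1 / ((k : ℝ) + 1) := by
  set e : ℕ → ℝ := fun n => ∫ p in recurrentSet i, succInd i j 0 p * succAvg i j n p ∂ν with he
  have hmono : Monotone fun n : ℕ => e (n + 1) - 1 / ((n : ℝ) + 1) := by
    refine monotone_nat_of_le_succ fun n => ?_
    have h1 : e (n + 1) - e (n + 1 + 1) ≤ 1 / ((n : ℝ) + 1 + 1) ^ 2 := by
      rw [he, ← setIntegral_succAvg_sub_sq hν i j n.succ_ne_zero (Nat.le_succ _)]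
      have h2 := norm_setIntegral_le_of_norm_le_const (μ := ν) (s := recurrentSet i)
        (f := fun p => (succAvg i j (n + 1) p - succAvg i j (n + 1 + 1) p) ^ 2)
        (C := 1 / ((n : ℝ) + 1 + 1) ^ 2) (measure_lt_top _ _) fun p _ => by
          have h3 := abs_succAvg_sub_succ_le i j (n + 1) p
          rw [norm_pow, Real.norm_eq_abs, ← one_div_pow]
          push_cast at h3
          gcongr
      refine (le_abs_self _).trans (h2.trans ?_)
      exact mul_le_of_le_one_right (by positivity) measureReal_le_one
    have h2 : 1 / ((n : ℝ) + 1 + 1) ^ 2 ≤ 1 / ((n : ℝ) + 1) - 1 / ((n : ℝ) + 1 + 1) := by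
      rw [div_sub_div _ _ (by positivity) (by positivity),
        div_le_div_iff₀ (by positivity) (by positivity)]
      nlinarith [(n.cast_nonneg : (0 : ℝ) ≤ n)]
    push_cast
    linarith
  have h := hmono hkl
  have h0 : 0 ≤ 1 / ((l : ℝ) + 1) := by positivity
  rw [setIntegral_succAvg_sub_sq hν i j k.succ_ne_zero (by omega)]
  simp only [he] at h
  linarith

lemma ae_exists_tendsto_succAvg_pow (hν : MarkovExchangeable ν fun n p => p n) (i j : 𝕊) :
    ∀ᵐ p ∂ν.restrict (recurrentSet i),
      ∃ a, Tendsto (fun n : ℕ => succAvg i j ((n + 1) ^ 4) p) atTop (𝓝 a) := by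
  set D : ℕ → (ℕ → 𝕊) → ℝ := fun n p =>
    succAvg i j ((n + 1) ^ 4) p - succAvg i j ((n + 1 + 1) ^ 4) p with hD
  have hDm (n : ℕ) : Measurable (D n) := by fun_prop
  have hle (n : ℕ) : eLpNorm (D n) 2 (ν.restrict (recurrentSet i))
      ≤ ENNReal.ofReal (1 / ((n : ℝ) + 1) ^ 2) := by
    have hmem : MemLp (D n) 2 (ν.restrict (recurrentSet i)) :=
      .of_bound (hDm n).aestronglyMeasurable 1 <| ae_of_all _ fun p => by
        rw [Real.norm_eq_abs, abs_le]
        constructor <;> linarith [succAvg_nonneg i j ((n + 1) ^ 4) p,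
          succAvg_le_one i j ((n + 1) ^ 4) p, succAvg_nonneg i j ((n + 1 + 1) ^ 4) p,
          succAvg_le_one i j ((n + 1 + 1) ^ 4) p]
    rw [hmem.eLpNorm_eq_integral_rpow_norm two_ne_zero ENNReal.ofNat_ne_top]
    refine ENNReal.ofReal_le_ofReal ?_
    have hsq : ∫ p in recurrentSet i, D n p ^ 2 ∂ν ≤ (1 / ((n : ℝ) + 1) ^ 2) ^ 2 := by
      obtain ⟨k, hk⟩ : ∃ k, (n + 1) ^ 4 = k + 1 := Nat.exists_eq_succ_of_ne_zero (by positivity)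
      obtain ⟨l, hl⟩ : ∃ l, (n + 1 + 1) ^ 4 = l + 1 :=
        Nat.exists_eq_succ_of_ne_zero (by positivity)
      have hkl : k ≤ l := by
        have : (n + 1) ^ 4 ≤ (n + 1 + 1) ^ 4 := by gcongr; omega
        omega
      have hk' : ((n : ℝ) + 1) ^ 4 = k + 1 := by exact_mod_cast hk
      simp only [hD, hk, hl]
      refine (setIntegral_succAvg_sub_sq_le hν i j hkl).trans_eq ?_
      rw [← hk', one_div_pow, ← pow_mul]
    simp only [ENNReal.toReal_ofNat, Real.rpow_ofNat, Real.norm_eq_abs, sq_abs]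
    rw [← one_div, ← Real.sqrt_eq_rpow]
    exact (Real.sqrt_le_left (by positivity)).2 hsq
  have hsum : ∑' n, eLpNorm (D n) 2 (ν.restrict (recurrentSet i)) ≠ ∞ := by
    refine ne_top_of_le_ne_top ?_ (ENNReal.tsum_le_tsum hle)
    refine Summable.tsum_ofReal_ne_top ?_
    simpa using (summable_nat_add_iff 1).2 (Real.summable_one_div_nat_pow.2 one_lt_two)
  filter_upwards [summable_norm_of_tsum_eLpNorm_ne_top one_le_two
    (fun n => (hDm n).aestronglyMeasurable) hsum] with p hp
  refine cauchySeq_tendsto_of_complete (cauchySeq_of_summable_dist ?_)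
  simpa [hD, Real.dist_eq] using hp

lemma ae_exists_tendsto_succAvg (hν : MarkovExchangeable ν fun n p => p n) :
    ∀ᵐ p ∂ν, ∀ i j, p ∈ recurrentSet i →
      ∃ a, Tendsto (fun l => succAvg i j l p) atTop (𝓝 a) := by
  refine ae_all_iff.2 fun i => ae_all_iff.2 fun j => ?_
  rw [← ae_restrict_iff' (measurableSet_recurrentSet i)]
  filter_upwards [ae_exists_tendsto_succAvg_pow hν i j] with p ⟨a, ha⟩
  exact ⟨a, tendsto_succAvg_of_tendsto_pow ha⟩

end Convergence

section FreqMatrix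

variable {𝕊 : Type*} {i j : 𝕊} {p q : ℕ → 𝕊}

/-- The (upper) limit of the normalized transition counts. -/
noncomputable def freqMatrix (p : ℕ → 𝕊) (i j : 𝕊) : ℝ :=
  limsup (fun n => (transCount n i j p : ℝ) / visitCount n i p) atTop

/-- The paths `p` and `q` have the same counts from some time on. -/
def EventuallyEqCounts (p q : ℕ → 𝕊) : Prop :=
  ∀ᶠ n in atTop, ∀ s t, transCount n s t p = transCount n s t q ∧
    visitCount n s p = visitCount n s q

lemma eventuallyEqCounts_blockMove (hp : p ∈ recurrentSet i) {r m : ℕ} (hrm : r ≤ m) :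
    EventuallyEqCounts (blockMove i r m p) p := by
  filter_upwards [eventually_ge_atTop (visitTime i (m + 1) p)] with n hn s t
  exact ⟨transCount_blockMove hp hrm s t hn, visitCount_blockMove hp hrm s hn⟩

lemma EventuallyEqCounts.freqMatrix_eq (h : EventuallyEqCounts p q) (i j : 𝕊) :
    freqMatrix p i j = freqMatrix q i j :=
  limsup_congr <| h.mono fun n hn => by rw [(hn i j).1, (hn i j).2]

lemma div_eq_succAvg (n : ℕ) (i j : 𝕊) (p : ℕ → 𝕊) :
    (transCount n i j p : ℝ) / visitCount n i p = succAvg i j (visitCount n i p) p := by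
  rw [transCount_eq_succCount, succAvg]

lemma freqMatrix_nonneg (p : ℕ → 𝕊) (i j : 𝕊) : 0 ≤ freqMatrix p i j :=
  le_limsup_of_le ⟨1, eventually_map.2 <| .of_forall fun n => by
    rw [div_eq_succAvg]; exact succAvg_le_one i j _ p⟩ fun _ hb =>
      let ⟨_, hn⟩ := hb.exists
      (by positivity : (0 : ℝ) ≤ _).trans hn

lemma freqMatrix_le_one (p : ℕ → 𝕊) (i j : 𝕊) : freqMatrix p i j ≤ 1 :=
  limsup_le_of_le (.of_frequently_ge (a := 0) <| .of_forall fun n => by positivity) <|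
    .of_forall fun n => by rw [div_eq_succAvg]; exact succAvg_le_one i j _ p

variable [MeasurableSpace 𝕊] [MeasurableSingletonClass 𝕊] [Countable 𝕊]

@[fun_prop]
lemma measurable_freqMatrix (i j : 𝕊) : Measurable fun p => freqMatrix p i j := by
  refine Measurable.limsup fun n => ?_
  simp_rw [div_eq_succAvg]
  exact (measurable_from_prod_countable_right (f := fun x : ℕ × (ℕ → 𝕊) => succAvg i j x.1 x.2)
    fun l => measurable_succAvg i j l).comp ((measurable_visitCount n i).prodMk measurable_id)

variable {ν : Measure (ℕ → 𝕊)} [IsProbabilityMeasure ν]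

lemma ae_tendsto_succAvg (hν : MarkovExchangeable ν fun n p => p n) :
    ∀ᵐ p ∂ν, ∀ i j, p ∈ recurrentSet i →
      Tendsto (fun l => succAvg i j l p) atTop (𝓝 (freqMatrix p i j)) := by
  filter_upwards [ae_exists_tendsto_succAvg hν] with p hp i j hi
  obtain ⟨a, ha⟩ := hp i j hi
  convert ha
  refine Tendsto.limsup_eq ?_
  simp_rw [div_eq_succAvg]
  exact ha.comp (tendsto_visitCount hi)

/-- The normalized transition counts converge almost surely. -/
lemma ae_tendsto_freqMatrix (hν : MarkovExchangeable ν fun n p => p n) {x₀ : 𝕊}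
    (h0 : ∀ᵐ p ∂ν, p 0 = x₀) (hrec : ∀ᵐ p ∂ν, p ∈ recurrentSet x₀) :
    ∀ᵐ p ∂ν, ∀ i j, Tendsto (fun n => (transCount n i j p : ℝ) / visitCount n i p) atTop
      (𝓝 (freqMatrix p i j)) := by
  filter_upwards [ae_tendsto_succAvg hν, ae_mem_recurrentSet_of_visited hν h0 hrec]
    with p hp hvis i j
  by_cases h : ∃ n, p n = i
  · obtain ⟨n, rfl⟩ := h
    simp_rw [div_eq_succAvg]
    exact (hp (p n) j (hvis n)).comp (tendsto_visitCount (hvis n))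
  · have h' (n : ℕ) : visitCount n i p = 0 := by
      have he : {m | m < n ∧ p m = i} = ∅ :=
        Set.eq_empty_of_forall_notMem fun m hm => h ⟨m, hm.2⟩
      rw [visitCount, he, Set.ncard_empty]
    simp [freqMatrix, h']

lemma ae_sum_freqMatrix_le_one (hν : MarkovExchangeable ν fun n p => p n) {x₀ : 𝕊}
    (h0 : ∀ᵐ p ∂ν, p 0 = x₀) (hrec : ∀ᵐ p ∂ν, p ∈ recurrentSet x₀) :
    ∀ᵐ p ∂ν, ∀ i (s : Finset 𝕊), ∑ j ∈ s, freqMatrix p i j ≤ 1 := by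
  filter_upwards [ae_tendsto_freqMatrix hν h0 hrec] with p hp i s
  refine le_of_tendsto (tendsto_finsetSum s fun j _ => hp i j) (.of_forall fun n => ?_)
  rw [← Finset.sum_div]
  exact div_le_one_of_le₀ (by exact_mod_cast sum_transCount_le_visitCount s n i p)
    (Nat.cast_nonneg _)

/-- Transition probabilities: conditionally on data invariant under the block moves, the step
following the visit number `r` to `i` is governed by the row `i` of `freqMatrix`. -/
lemma setIntegral_succInd_mul_eq (hν : MarkovExchangeable ν fun n p => p n) (i j : 𝕊) (r : ℕ)
    {H : (ℕ → 𝕊) → ℝ} (hH : Measurable H) (hH0 : ∀ p, 0 ≤ H p) (hH1 : ∀ p, H p ≤ 1)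
    (hinv : ∀ m, r ≤ m → ∀ p ∈ recurrentSet i, H (blockMove i r m p) = H p) :
    ∫ p in recurrentSet i, succInd i j r p * H p ∂ν
      = ∫ p in recurrentSet i, freqMatrix p i j * H p ∂ν := by
  have h1 : Tendsto (fun m => ∫ p in recurrentSet i, succInd i j m p * H p ∂ν) atTop
      (𝓝 (∫ p in recurrentSet i, succInd i j r p * H p ∂ν)) :=
    tendsto_const_nhds.congr' <| (eventually_ge_atTop r).mono fun m hm =>
      setIntegral_succInd_mul hν i j hm hH (hinv m hm)
  have h2 (l : ℕ) : (l : ℝ)⁻¹ * ∑ m ∈ Finset.range l,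
      ∫ p in recurrentSet i, succInd i j m p * H p ∂ν
        = ∫ p in recurrentSet i, succAvg i j l p * H p ∂ν := by
    rw [← integral_finsetSum, ← integral_const_mul]
    · refine integral_congr_ae (ae_of_all _ fun p => ?_)
      simp only [← Finset.sum_mul, succAvg, succCount]
      ring
    · exact fun m _ => integrable_of_nonneg_of_le_one (by fun_prop)
        (fun p => mul_nonneg (succInd_nonneg i j m p) (hH0 p))
        (fun p => mul_le_one₀ (succInd_le_one i j m p) (hH0 p) (hH1 p))
  have h3 := h1.cesaro
  simp only [h2] at h3
  refine tendsto_nhds_unique h3 (tendsto_integral_of_dominated_convergence (fun _ => 1)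
    (fun l => by fun_prop) (integrable_const 1) (fun l => ae_of_all _ fun p => ?_) ?_)
  · rw [Real.norm_of_nonneg (mul_nonneg (succAvg_nonneg i j l p) (hH0 p))]
    exact mul_le_one₀ (succAvg_le_one i j l p) (hH0 p) (hH1 p)
  · rw [ae_restrict_iff' (measurableSet_recurrentSet i)]
    filter_upwards [ae_tendsto_succAvg hν] with p hp hi
    exact (hp i j hi).mul_const _

lemma ae_tsum_freqMatrix (hν : MarkovExchangeable ν fun n p => p n) {x₀ : 𝕊}
    (h0 : ∀ᵐ p ∂ν, p 0 = x₀) (hrec : ∀ᵐ p ∂ν, p ∈ recurrentSet x₀) :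
    ∀ᵐ p ∂ν, ∀ i, ∑' j, freqMatrix p i j ≤ 1 ∧
      (p ∈ recurrentSet i → ∑' j, freqMatrix p i j = 1) := by
  have hle := ae_sum_freqMatrix_le_one hν h0 hrec
  have hofReal : ∀ᵐ p ∂ν, ∀ i, ∑' j, ENNReal.ofReal (freqMatrix p i j)
      = ENNReal.ofReal (∑' j, freqMatrix p i j) := by
    filter_upwards [hle] with p hp i
    exact (ENNReal.ofReal_tsum_of_nonneg (freqMatrix_nonneg p i)
      (summable_of_sum_le (freqMatrix_nonneg p i) (hp i))).symm
  have hle' : ∀ᵐ p ∂ν, ∀ i, ∑' j, freqMatrix p i j ≤ 1 := by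
    filter_upwards [hle] with p hp i
    exact Real.tsum_le_of_sum_le (freqMatrix_nonneg p i) (hp i)
  have hone (i : 𝕊) : ∀ᵐ p ∂ν.restrict (recurrentSet i),
      ∑' j, ENNReal.ofReal (freqMatrix p i j) = 1 := by
    refine ae_eq_of_ae_le_of_lintegral_le (g := fun _ => 1) (ae_restrict_of_ae ?_) ?_
      aemeasurable_const ?_
    · filter_upwards [hofReal, hle'] with p h1 h2
      rw [h1]
      exact ENNReal.ofReal_le_one.2 (h2 i)
    · refine ne_top_of_le_ne_top (measure_ne_top (ν.restrict (recurrentSet i)) .univ) ?_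
      rw [← lintegral_one]
      refine lintegral_mono_ae (ae_restrict_of_ae ?_)
      filter_upwards [hofReal, hle'] with p h1 h2
      rw [h1]
      exact ENNReal.ofReal_le_one.2 (h2 i)
    · have hj (j : 𝕊) : ∫⁻ p in recurrentSet i, ENNReal.ofReal (succInd i j 0 p) ∂ν
          = ∫⁻ p in recurrentSet i, ENNReal.ofReal (freqMatrix p i j) ∂ν := by
        have h := setIntegral_succInd_mul_eq hν i j 0 (H := fun _ => 1) measurable_const
          (fun _ => zero_le_one) (fun _ => le_rfl) fun _ _ _ _ => rfl
        simp only [mul_one] at h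
        rw [← ofReal_integral_eq_lintegral_ofReal, h, ofReal_integral_eq_lintegral_ofReal]
        · exact integrable_of_nonneg_of_le_one (measurable_freqMatrix i j)
            (fun p => freqMatrix_nonneg p i j) fun p => freqMatrix_le_one p i j
        · exact ae_of_all _ fun p => freqMatrix_nonneg p i j
        · exact integrable_of_nonneg_of_le_one (measurable_succInd i j 0)
            (succInd_nonneg i j 0) (succInd_le_one i j 0)
        · exact ae_of_all _ (succInd_nonneg i j 0)
      rw [lintegral_tsum fun j => (by fun_prop), ← tsum_congr hj,
        ← lintegral_tsum fun j => (by fun_prop)]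
      refine lintegral_mono fun p => ?_
      refine le_trans ?_ (ENNReal.le_tsum (p (visitTime i 0 p + 1)))
      simp [succInd]
  have hone' : ∀ᵐ p ∂ν, ∀ i, p ∈ recurrentSet i →
      ∑' j, ENNReal.ofReal (freqMatrix p i j) = 1 :=
    ae_all_iff.2 fun i => (ae_restrict_iff' (measurableSet_recurrentSet i)).1 (hone i)
  filter_upwards [hofReal, hle', hone'] with p h1 h2 h3 i
  exact ⟨h2 i, fun hi => ENNReal.ofReal_eq_one.1 ((h1 i).symm.trans (h3 i hi))⟩

end FreqMatrix

section MarkovProperty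

variable {𝕊 : Type*} {i : 𝕊} {p : ℕ → 𝕊}

lemma visitTime_of_mem_prefixSet {n : ℕ} {u : ℕ → 𝕊} (hp : p ∈ prefixSet n u)
    (hi : p ∈ recurrentSet (u n)) : visitTime (u n) (visitCount n (u n) u) p = n :=
  (visitTime_eq_iff hi).2 ⟨hp n le_rfl, visitCount_congr hp⟩

lemma blockMove_mem_prefixSet_iff {n m : ℕ} {u : ℕ → 𝕊} (hi : p ∈ recurrentSet (u n))
    (hm : visitCount n (u n) u ≤ m) :
    blockMove (u n) (visitCount n (u n) u) m p ∈ prefixSet n u ↔ p ∈ prefixSet n u := by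
  have hi' := (blockMove_mem_recurrentSet_iff (r := visitCount n (u n) u) (m := m)
    (i := u n) (u n)).2 hi
  constructor
  · intro h k hk
    have ht := visitTime_of_mem_prefixSet h hi'
    rw [visitTime_blockMove_self hi hm] at ht
    rw [← h k hk, blockMove_of_le hi hm (hk.trans ht.ge)]
  · intro h k hk
    have ht := visitTime_of_mem_prefixSet h hi
    rw [← h k hk, blockMove_of_le hi hm (hk.trans ht.ge)]

lemma indicator_prefixSet_succ {n : ℕ} {u : ℕ → 𝕊}
    (hi : p ∈ prefixSet n u → p ∈ recurrentSet (u n)) :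
    (prefixSet (n + 1) u).indicator (1 : (ℕ → 𝕊) → ℝ) p
      = (recurrentSet (u n)).indicator (1 : (ℕ → 𝕊) → ℝ) p
        * (succInd (u n) (u (n + 1)) (visitCount n (u n) u) p
          * (prefixSet n u).indicator (1 : (ℕ → 𝕊) → ℝ) p) := by
  classical
  by_cases hp : p ∈ prefixSet n u
  · have h : p ∈ prefixSet (n + 1) u ↔ p (n + 1) = u (n + 1) :=
      ⟨fun h => h _ le_rfl, fun h m hm => (Nat.le_succ_iff.1 hm).elim (hp m) fun hm => hm ▸ h⟩
    simp [hp, hi hp, succInd, visitTime_of_mem_prefixSet hp (hi hp), Set.indicator_apply, h]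
  · have h : p ∉ prefixSet (n + 1) u := fun h => hp fun m hm => h m (hm.trans n.le_succ)
    simp [hp, h]

variable [MeasurableSpace 𝕊] [MeasurableSingletonClass 𝕊] [Countable 𝕊]
  {ν : Measure (ℕ → 𝕊)} [IsProbabilityMeasure ν]

lemma integral_indicator_prefixSet_mul (hν : MarkovExchangeable ν fun n p => p n) {x₀ : 𝕊}
    (h0 : ∀ᵐ p ∂ν, p 0 = x₀) (hrec : ∀ᵐ p ∂ν, p ∈ recurrentSet x₀) (n : ℕ) (u : ℕ → 𝕊)
    (hu : u 0 = x₀) {G : (ℕ → 𝕊) → ℝ} (hG : Measurable G) (hG0 : ∀ p, 0 ≤ G p)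
    (hG1 : ∀ p, G p ≤ 1) (hinv : ∀ p q, EventuallyEqCounts p q → G p = G q) :
    ∫ p, (prefixSet n u).indicator 1 p * G p ∂ν
      = ∫ p, (∏ m ∈ Finset.range n, freqMatrix p (u m) (u (m + 1))) * G p ∂ν := by
  induction n generalizing G with
  | zero =>
    refine integral_congr_ae ?_
    filter_upwards [h0] with p hp
    have : p ∈ prefixSet 0 u := fun m hm => by rw [Nat.le_zero.1 hm, hp, hu]
    simp [this]
  | succ n ih =>
    set i := u n
    set j := u (n + 1)
    have hind0 (p : ℕ → 𝕊) : 0 ≤ (prefixSet n u).indicator (1 : (ℕ → 𝕊) → ℝ) p :=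
      Set.indicator_nonneg (fun _ _ => zero_le_one) _
    have hind1 (p : ℕ → 𝕊) : (prefixSet n u).indicator (1 : (ℕ → 𝕊) → ℝ) p ≤ 1 :=
      Set.indicator_le_self' (fun _ _ => zero_le_one) _
    have hindm : Measurable ((prefixSet n u).indicator (1 : (ℕ → 𝕊) → ℝ)) :=
      measurable_one.indicator (measurableSet_prefixSet n u)
    have hI := measurableSet_recurrentSet i
    have hvis : ∀ᵐ p ∂ν, p ∈ prefixSet n u → p ∈ recurrentSet i := by
      filter_upwards [ae_mem_recurrentSet_of_visited hν h0 hrec] with p hp hpu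
      have h : p n = i := hpu n le_rfl
      exact h ▸ hp n
    calc ∫ p, (prefixSet (n + 1) u).indicator 1 p * G p ∂ν
        = ∫ p in recurrentSet i, succInd i j (visitCount n i u) p
            * ((prefixSet n u).indicator 1 p * G p) ∂ν := by
          rw [← integral_indicator hI]
          refine integral_congr_ae ?_
          filter_upwards [hvis] with p hp
          rw [indicator_prefixSet_succ hp]
          by_cases h : p ∈ recurrentSet i <;> simp [h, i, j, mul_assoc]
      _ = ∫ p in recurrentSet i, freqMatrix p i j
            * ((prefixSet n u).indicator 1 p * G p) ∂ν := by
          refine setIntegral_succInd_mul_eq hν i j _ (hindm.mul hG)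
            (fun p => mul_nonneg (hind0 p) (hG0 p))
            (fun p => mul_le_one₀ (hind1 p) (hG0 p) (hG1 p)) fun m hm p hp => ?_
          classical
          have hmem : blockMove i (visitCount n i u) m p ∈ prefixSet n u ↔ p ∈ prefixSet n u :=
            blockMove_mem_prefixSet_iff hp hm
          simp only [hinv _ _ (eventuallyEqCounts_blockMove hp hm), Set.indicator_apply, hmem,
            Pi.one_apply]
      _ = ∫ p, (prefixSet n u).indicator 1 p * (freqMatrix p i j * G p) ∂ν := by
          rw [← integral_indicator hI]
          refine integral_congr_ae ?_
          filter_upwards [hvis] with p hp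
          by_cases h : p ∈ recurrentSet i
          · simp only [h, Set.indicator_of_mem]; ring
          · simp [h, mt hp h]
      _ = ∫ p, (∏ m ∈ Finset.range n, freqMatrix p (u m) (u (m + 1)))
            * (freqMatrix p i j * G p) ∂ν :=
          ih ((measurable_freqMatrix i j).mul hG)
            (fun p => mul_nonneg (freqMatrix_nonneg p i j) (hG0 p))
            (fun p => mul_le_one₀ (freqMatrix_le_one p i j) (hG0 p) (hG1 p))
            fun p q h => by rw [h.freqMatrix_eq, hinv p q h]
      _ = ∫ p, (∏ m ∈ Finset.range (n + 1), freqMatrix p (u m) (u (m + 1))) * G p ∂ν := by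
          simp_rw [Finset.prod_range_succ, mul_assoc]
          rfl

/-- Conditionally on `freqMatrix`, the coordinate process is a Markov chain. -/
lemma measure_prefixSet_eq_lintegral (hν : MarkovExchangeable ν fun n p => p n) {x₀ : 𝕊}
    (h0 : ∀ᵐ p ∂ν, p 0 = x₀) (hrec : ∀ᵐ p ∂ν, p ∈ recurrentSet x₀) (n : ℕ) (u : ℕ → 𝕊)
    (hu : u 0 = x₀) :
    ν (prefixSet n u)
      = ∫⁻ p, ∏ m ∈ Finset.range n, ENNReal.ofReal (freqMatrix p (u m) (u (m + 1))) ∂ν := by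
  have h := integral_indicator_prefixSet_mul hν h0 hrec n u hu (G := fun _ => 1)
    measurable_const (fun _ => zero_le_one) (fun _ => le_rfl) fun _ _ _ => rfl
  simp only [mul_one] at h
  rw [integral_indicator_one (measurableSet_prefixSet n u)] at h
  simp_rw [← ENNReal.ofReal_prod_of_nonneg fun m (_ : m ∈ Finset.range n) =>
    freqMatrix_nonneg _ (u m) (u (m + 1))]
  rw [← ofReal_integral_eq_lintegral_ofReal, ← h, ofReal_measureReal]
  · exact integrable_of_nonneg_of_le_one (by fun_prop)
      (fun p => Finset.prod_nonneg fun m _ => freqMatrix_nonneg p _ _)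
      (fun p => Finset.prod_le_one (fun m _ => freqMatrix_nonneg p _ _)
        fun m _ => freqMatrix_le_one p _ _)
  · exact ae_of_all _ fun p => Finset.prod_nonneg fun m _ => freqMatrix_nonneg p _ _

end MarkovProperty

end MarkovExchangeable

/-- **Diaconis–Freedman representation theorem for recurrent Markov exchangeable processes.**
If the process is recurrent and Markov exchangeable then the normalized transition counts
converge a.s. (coordinatewise) to a random matrix `Q̃` (nonnegative, with sub-stochastic rows,
the rows of the states visited infinitely often summing to one), and conditionally on `Q̃` the
process is a Markov chain with transition matrix `Q̃`. -/
theorem statement12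
    {Ω 𝕊 : Type*} [MeasurableSpace Ω] [MeasurableSpace 𝕊] [MeasurableSingletonClass 𝕊]
    [Countable 𝕊] [Nontrivial 𝕊]
    (μ : Measure Ω) [IsProbabilityMeasure μ]
    (Z : ℕ → Ω → 𝕊) (hZ : ∀ n, Measurable (Z n))
    (x₀ : 𝕊) (hstart : ∀ᵐ ω ∂μ, Z 0 ω = x₀)
    (hrec : ∀ᵐ ω ∂μ, {n | Z n ω = x₀}.Infinite)
    (hme : MarkovExchangeable μ Z) :
    ∃ Q : Ω → 𝕊 → 𝕊 → ℝ,
      (∀ i j, Measurable fun ω => Q ω i j) ∧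
      -- `Q̃` is a (sub)stochastic random matrix
      (∀ᵐ ω ∂μ, ∀ i j, 0 ≤ Q ω i j) ∧
      (∀ᵐ ω ∂μ, ∀ i, (∑' j, Q ω i j) ≤ 1 ∧
        ({n | Z n ω = i}.Infinite → ∑' j, Q ω i j = 1)) ∧
      -- (i) the normalized transition counts converge a.s. coordinatewise to `Q̃`
      (∀ᵐ ω ∂μ, ∀ i j : 𝕊,
        Tendsto (fun n =>
            (transCount n i j (fun m => Z m ω) : ℝ) / (visitCount n i (fun m => Z m ω) : ℝ))
          atTop (𝓝 (Q ω i j))) ∧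
      -- (ii) conditionally on `Q̃`, the process is a Markov chain with transition matrix `Q̃`
      (∀ (n : ℕ) (u : ℕ → 𝕊), u 0 = x₀ →
        μ {ω | ∀ m ≤ n, Z m ω = u m}
          = ∫⁻ ω, ∏ m ∈ Finset.range n, ENNReal.ofReal (Q ω (u m) (u (m + 1))) ∂μ) := by
  set W : Ω → ℕ → 𝕊 := fun ω n => Z n ω
  have hW : Measurable W := measurable_pi_lambda _ hZ
  set ν := μ.map W
  have : IsProbabilityMeasure ν := Measure.isProbabilityMeasure_map hW.aemeasurable
  have hpre (n : ℕ) (u : ℕ → 𝕊) : ν (MarkovExchangeable.prefixSet n u)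
      = μ {ω | ∀ m ≤ n, Z m ω = u m} :=
    Measure.map_apply hW (MarkovExchangeable.measurableSet_prefixSet n u)
  have hν : MarkovExchangeable ν fun n p => p n := fun n u v h0 h =>
    (hpre n u).trans ((hme n u v h0 h).trans (hpre n v).symm)
  have h0 : ∀ᵐ p ∂ν, p 0 = x₀ := (ae_map_iff hW.aemeasurable
    (MarkovExchangeable.measurableSet_apply_eq 0 x₀)).2 hstart
  have hrec' : ∀ᵐ p ∂ν, p ∈ MarkovExchangeable.recurrentSet x₀ := (ae_map_iff hW.aemeasurable
    (MarkovExchangeable.measurableSet_recurrentSet x₀)).2 hrec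
  have hsum := ae_of_ae_map hW.aemeasurable (MarkovExchangeable.ae_tsum_freqMatrix hν h0 hrec')
  refine ⟨fun ω => MarkovExchangeable.freqMatrix (W ω),
    fun i j => (MarkovExchangeable.measurable_freqMatrix i j).comp hW,
    ae_of_all _ fun ω i j => MarkovExchangeable.freqMatrix_nonneg _ i j, hsum,
    ae_of_ae_map hW.aemeasurable (MarkovExchangeable.ae_tendsto_freqMatrix hν h0 hrec'),
    fun n u hu => ?_⟩
  rw [← hpre n u, MarkovExchangeable.measure_prefixSet_eq_lintegral hν h0 hrec' n u hu,
    lintegral_map (by fun_prop) hW]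
end
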